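/- arXiv:math/0702755 — 6 statements merged into one kernel-verified Lean document; each statement's English description precedes it below -/
import Mathlib

section
/- Let F be a field of characteristic p > 0 with [F : F^p] < ∞. The assignments E ↦ Der_E(F) and L ↦ E_L := { x ∈ F : D(x) = 0 for all D ∈ L } give mutually inverse bijections between the set of intermediate fields E with F^p ⊆ E ⊆ F (the inseparable subextensions of exponent 1) and the set of restricted Lie subalgebras of Der(F) = Der_{F^p}(F). -/
/-!
STATEMENT 3 (Jacobson's Galois correspondence for exponent-one extensions):
for a field `F` of characteristic `p > 0` with `[F : F^p] < ∞`, the assignments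
`E ↦ Der_E(F)` and `L ↦ E_L = {x ∈ F | D x = 0 ∀ D ∈ L}` are mutually inverse bijections
between the intermediate fields `F^p ⊆ E ⊆ F` and the restricted Lie subalgebras of
`Der(F) = Der_{F^p}(F)`.

Derivations of `F` (over its prime field, equivalently over `F^p`) are realized as the
additive (`ℤ`-linear) endomorphisms of `F` satisfying the Leibniz rule; such maps are
automatically `F^p`-linear.  A restricted subalgebra of `Der(F)` is a subset consisting
of derivations which is an `F`-subspace closed under the commutator bracket and under
the `p`-map `D ↦ D^p` (the `p`-th iterate).
-/

set_option maxHeartbeats 1000000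

/-- The subfield `F^p` of `p`-th powers, i.e. the range of the Frobenius. -/
noncomputable def pthPowers (F : Type*) [Field F] (p : ℕ) [Fact p.Prime] [CharP F p] :
    Subfield F :=
  (frobenius F p).fieldRange

/-- `D` is a derivation of `F` (over the prime field): an additive endomorphism
satisfying the Leibniz rule. -/
def IsDer {F : Type*} [Field F] (D : Module.End ℤ F) : Prop :=
  ∀ a b : F, D (a * b) = D a * b + a * D b

/-- The derivations of `F` vanishing on a subfield `E`, i.e. `Der_E(F)`. -/
def DerOver {F : Type*} [Field F] (E : Subfield F) : Set (Module.End ℤ F) :=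
  {D | IsDer D ∧ ∀ e ∈ E, D e = 0}

/-- The fixed field `E_L = {x ∈ F | D x = 0 for all D ∈ L}` of a set of derivations. -/
def fixedSet {F : Type*} [Field F] (L : Set (Module.End ℤ F)) : Set F :=
  {x | ∀ D ∈ L, D x = 0}

/-- `S` is a restricted Lie subalgebra of `Der(F)`:  a set of derivations of `F` which
is an `F`-subspace, closed under the bracket and under the `p`-th iterate `D ↦ D^p`. -/
def IsRestrictedSubalgebra (F : Type*) [Field F] (p : ℕ)
    (S : Set (Module.End ℤ F)) : Prop :=
  (∀ D ∈ S, IsDer D) ∧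
  (0 : Module.End ℤ F) ∈ S ∧
  (∀ D ∈ S, ∀ D' ∈ S, D + D' ∈ S) ∧
  (∀ (c : F), ∀ D ∈ S, c • D ∈ S) ∧
  (∀ D ∈ S, ∀ D' ∈ S, ⁅D, D'⁆ ∈ S) ∧
  (∀ D ∈ S, D ^ p ∈ S)

open Module Polynomial

namespace IsDer

variable {F : Type*} [Field F] {D D' : Module.End ℤ F}

lemma map_one (hD : IsDer D) : D 1 = 0 := by
  simpa using hD 1 1

lemma add (hD : IsDer D) (hD' : IsDer D') : IsDer (D + D') := by
  intro a b
  simp only [LinearMap.add_apply, hD a b, hD' a b]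
  ring

lemma smul (c : F) (hD : IsDer D) : IsDer (c • D) := by
  intro a b
  simp only [LinearMap.smul_apply, hD a b, smul_eq_mul]
  ring

lemma lie (hD : IsDer D) (hD' : IsDer D') : IsDer ⁅D, D'⁆ := by
  intro a b
  simp only [Ring.lie_def, LinearMap.sub_apply, Module.End.mul_apply, hD _ _, hD' _ _, map_add]
  ring

lemma map_pow (hD : IsDer D) (a : F) (n : ℕ) : D (a ^ n) = n * a ^ (n - 1) * D a := by
  induction n with
  | zero => simpa using hD.map_one
  | succ n ih =>
    rw [pow_succ, hD, ih]
    rcases n with _ | n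
    · simp
    · simp only [Nat.add_sub_cancel, Nat.cast_succ, pow_succ]
      ring

lemma map_inv (hD : IsDer D) {a : F} (ha : D a = 0) : D a⁻¹ = 0 := by
  rcases eq_or_ne a 0 with rfl | h
  · simp
  · have := hD a a⁻¹
    rw [mul_inv_cancel₀ h, hD.map_one, ha, zero_mul, zero_add] at this
    exact (mul_eq_zero.mp this.symm).resolve_left h

/-- The Leibniz formula for the iterates of a derivation. -/
lemma pow_apply_mul (hD : IsDer D) (n : ℕ) (a b : F) :
    (D ^ n) (a * b) =
      ∑ ij ∈ Finset.HasAntidiagonal.antidiagonal n,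
        (n.choose ij.1 : F) * ((D ^ ij.1) a * (D ^ ij.2) b) := by
  induction n with
  | zero => simp
  | succ n ih =>
    have hcast (m : ℕ) (x : F) : D (m * x) = m * D x := by
      rw [← nsmul_eq_mul, map_nsmul, nsmul_eq_mul]
    rw [Finset.sum_antidiagonal_choose_succ_mul (fun i j => (D ^ i) a * (D ^ j) b), pow_succ',
      Module.End.mul_apply, ih, map_sum, ← Finset.sum_add_distrib]
    refine Finset.sum_congr rfl fun ij hij => ?_
    rw [hcast, hD, n.choose_symm_of_eq_add (Finset.HasAntidiagonal.mem_antidiagonal.1 hij).symm]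
    simp only [pow_succ', Module.End.mul_apply]
    ring

variable {p : ℕ} [CharP F p]

lemma map_pow_char (hD : IsDer D) (a : F) : D (a ^ p) = 0 := by
  rw [hD.map_pow, CharP.cast_eq_zero, zero_mul, zero_mul]

variable [Fact p.Prime]

lemma map_pthPowers (hD : IsDer D) {a : F} (ha : a ∈ pthPowers F p) : D a = 0 := by
  obtain ⟨b, rfl⟩ := ha
  exact hD.map_pow_char b

lemma pow_char (hD : IsDer D) : IsDer (D ^ p) := by
  intro a b
  have hp : p.Prime := Fact.out
  have hne : ((p, 0) : ℕ × ℕ) ≠ (0, p) := by simp [hp.ne_zero]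
  rw [hD.pow_apply_mul, ← Finset.sum_subset (s₁ := {(p, 0), (0, p)}), Finset.sum_pair hne]
  · simp
  · intro ij hij
    rcases Finset.mem_insert.mp hij with rfl | h
    · simp
    · rw [Finset.mem_singleton.mp h]; simp
  · rintro ⟨i, j⟩ hij hn
    rw [Finset.HasAntidiagonal.mem_antidiagonal] at hij
    simp only [Finset.mem_insert, Finset.mem_singleton, Prod.mk.injEq, not_or] at hn
    have : p ∣ p.choose i := hp.dvd_choose_self (by omega) (by omega)
    rw [(CharP.cast_eq_zero_iff F p _).mpr this, zero_mul]

end IsDer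

section Correspondence

variable {F : Type*} [Field F]

/-- The subfield of constants of a set of derivations. -/
def fixedSubfield (S : Set (Module.End ℤ F)) (hS : ∀ D ∈ S, IsDer D) : Subfield F where
  carrier := fixedSet S
  zero_mem' D _ := map_zero D
  one_mem' D hD := (hS D hD).map_one
  add_mem' ha hb D hD := by rw [map_add, ha D hD, hb D hD, add_zero]
  neg_mem' ha D hD := by rw [map_neg, ha D hD, neg_zero]
  mul_mem' ha hb D hD := by rw [hS D hD, ha D hD, hb D hD, zero_mul, mul_zero, add_zero]
  inv_mem' _ ha D hD := (hS D hD).map_inv (ha D hD)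

lemma isRestrictedSubalgebra_derOver (p : ℕ) [Fact p.Prime] [CharP F p] (E : Subfield F) :
    IsRestrictedSubalgebra F p (DerOver E) := by
  refine ⟨fun D hD => hD.1, ⟨fun a b => by simp, fun e _ => rfl⟩, ?_, ?_, ?_, ?_⟩
  · exact fun D hD D' hD' => ⟨hD.1.add hD'.1, fun e he => by simp [hD.2 e he, hD'.2 e he]⟩
  · exact fun c D hD => ⟨hD.1.smul c, fun e he => by simp [hD.2 e he]⟩
  · exact fun D hD D' hD' => ⟨hD.1.lie hD'.1, fun e he => by
      simp [Ring.lie_def, hD.2 e he, hD'.2 e he]⟩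
  · refine fun D hD => ⟨hD.1.pow_char, fun e he => ?_⟩
    obtain ⟨n, hn⟩ := Nat.exists_eq_succ_of_ne_zero (Fact.out : p.Prime).ne_zero
    rw [hn, pow_succ, Module.End.mul_apply, hD.2 e he, map_zero]

/-- A subfield is contained in one that is maximal among those avoiding a given element. -/
lemma Subfield.exists_le_maximal_notMem (E : Subfield F) {x : F} (hx : x ∉ E) :
    ∃ M, E ≤ M ∧ Maximal (fun M : Subfield F => x ∉ M) M := by
  refine zorn_le_nonempty₀ {M : Subfield F | x ∉ M} (fun c hc hchain y hy => ?_) E hx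
  refine ⟨sSup c, fun hmem => ?_, fun _ => le_sSup⟩
  obtain ⟨M, hM, hxM⟩ := (Subfield.mem_sSup_of_directedOn ⟨y, hy⟩ hchain.directedOn).mp hmem
  exact hc hM hxM

lemma finrank_adjoin_eq_char (p : ℕ) [Fact p.Prime] [CharP F p] {M : Subfield F}
    (hM : pthPowers F p ≤ M) {y : F} (hy : y ∉ M) :
    finrank M (IntermediateField.adjoin M {y}) = p := by
  have hyp : y ^ p ∈ M := hM ⟨y, rfl⟩
  have hp : p.Prime := Fact.out
  have hirr : Irreducible (X ^ p - C (⟨y ^ p, hyp⟩ : M)) := by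
    refine X_pow_sub_C_irreducible_of_prime hp fun b hb => hy ?_
    have h : (b : F) ^ p = y ^ p := congrArg Subtype.val hb
    rw [← frobenius_inj F p h]
    exact b.2
  have hmonic := monic_X_pow_sub_C (⟨y ^ p, hyp⟩ : M) hp.ne_zero
  have hroot : aeval y (X ^ p - C (⟨y ^ p, hyp⟩ : M)) = 0 := by
    simp [Algebra.algebraMap_eq_smul_one, Subfield.smul_def]
  rw [IntermediateField.adjoin.finrank ⟨_, hmonic, hroot⟩,
    ← minpoly.eq_of_irreducible_of_monic hirr hroot hmonic, natDegree_X_pow_sub_C]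

/-- If `M` is maximal among the subfields avoiding `x`, then `F = M(x)`. -/
lemma adjoin_eq_top_of_maximal (p : ℕ) [Fact p.Prime] [CharP F p] {M : Subfield F} {x : F}
    (hM : pthPowers F p ≤ M) (hmax : Maximal (fun M : Subfield F => x ∉ M) M) :
    IntermediateField.adjoin M {x} = ⊤ := by
  have hp : p.Prime := Fact.out
  refine eq_top_iff.mpr fun y _ => ?_
  by_cases hy : y ∈ M
  · exact (IntermediateField.adjoin M {x}).algebraMap_mem ⟨y, hy⟩
  have hyy := IntermediateField.mem_adjoin_simple_self M y
  have hxy : x ∈ IntermediateField.adjoin M {y} := by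
    by_contra hxy
    exact hy (hmax.2 (y := (IntermediateField.adjoin M {y}).toSubfield) hxy
      (fun m hm => (IntermediateField.adjoin M {y}).algebraMap_mem ⟨m, hm⟩) hyy)
  have hfin : FiniteDimensional M (IntermediateField.adjoin M {y}) :=
    FiniteDimensional.of_finrank_pos (by
      rw [finrank_adjoin_eq_char p hM hy]
      exact hp.pos)
  rwa [IntermediateField.eq_of_le_of_finrank_eq
    (IntermediateField.adjoin_simple_le_iff.mpr hxy)
    (by rw [finrank_adjoin_eq_char p hM hy, finrank_adjoin_eq_char p hM hmax.1])]

/-- The additive endomorphism underlying a derivation lies in `DerOver`. -/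
lemma derivation_mem_derOver {M : Subfield F} (d : Derivation M F F) :
    (d : F →+ F).toIntLinearMap ∈ DerOver M := by
  refine ⟨fun a b => ?_, fun e he => ?_⟩
  · have := d.leibniz a b
    simp only [smul_eq_mul] at this
    change d (a * b) = d a * b + a * d b
    rw [this]
    ring
  · exact d.map_algebraMap ⟨e, he⟩

lemma exists_mem_derOver_apply_ne_zero (p : ℕ) [Fact p.Prime] [CharP F p]
    {E : Subfield F} (hE : pthPowers F p ≤ E) {x : F}
    (hx : x ∉ E) : ∃ D ∈ DerOver E, D x ≠ 0 := by
  obtain ⟨M, hEM, hmax⟩ := E.exists_le_maximal_notMem hx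
  have hM := hE.trans hEM
  have htop := adjoin_eq_top_of_maximal p hM hmax
  have hfin : FiniteDimensional M F := by
    refine FiniteDimensional.of_finrank_pos ?_
    rw [← IntermediateField.finrank_top', ← htop, finrank_adjoin_eq_char p hM hmax.1]
    exact (Fact.out : p.Prime).pos
  by_contra! hzero
  have hder (d : Derivation M F F) : d = 0 := by
    have hmem := derivation_mem_derOver d
    have hdx : d x = 0 := hzero _ ⟨hmem.1, fun e he => hmem.2 e (hEM he)⟩
    have hle : IntermediateField.adjoin M {x} ≤
        (fixedSubfield {(d : F →+ F).toIntLinearMap} (by simpa using hmem.1)).toIntermediateField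
          (fun m => by rintro _ rfl; exact d.map_algebraMap m) := by
      rw [IntermediateField.adjoin_simple_le_iff]
      rintro _ rfl
      exact hdx
    rw [htop] at hle
    ext y
    exact hle (IntermediateField.mem_top (x := y)) _ rfl
  have hsub : Subsingleton (Ω[F⁄M]) := by
    refine subsingleton_of_forall_eq 0 fun w => ?_
    rw [← Module.forall_dual_apply_eq_zero_iff F]
    intro f
    have : f = 0 := (KaehlerDifferential.linearMapEquivDerivation M F).injective
      ((hder _).trans (hder _).symm)
    rw [this, LinearMap.zero_apply]
  have : Algebra.FormallyUnramified M F := ⟨hsub⟩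
  have hsep := Algebra.FormallyUnramified.isSeparable M F
  have : CharP M p := inferInstance
  have : ExpChar M p := inferInstance
  have : IsPurelyInseparable M F := (isPurelyInseparable_iff_pow_mem M p).mpr fun y =>
    ⟨1, ⟨⟨y ^ p, hM ⟨y, rfl⟩⟩, (pow_one p).symm ▸ rfl⟩⟩
  obtain ⟨m, hm⟩ := IsPurelyInseparable.inseparable M x (Algebra.IsSeparable.isSeparable M x)
  exact hmax.1 (hm ▸ m.2)

lemma fixedSet_derOver (p : ℕ) [Fact p.Prime] [CharP F p]
    {E : Subfield F} (hE : pthPowers F p ≤ E) :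
    fixedSet (DerOver E) = (E : Set F) := by
  refine Set.Subset.antisymm (fun x hx => ?_) fun x hx D hD => hD.2 x hx
  by_contra hxE
  obtain ⟨D, hD, hDx⟩ := exists_mem_derOver_apply_ne_zero p hE hxE
  exact hDx (hx D hD)

/-- A finite-dimensional space of endomorphisms has a basis dual to a family of elements. -/
lemma exists_dual_family.{u} {F : Type u} [Field F] (V : Submodule F (Module.End ℤ F))
    [FiniteDimensional F V] :
    ∃ (ι : Type u) (_ : Fintype ι) (x : ι → F) (D : ι → Module.End ℤ F),
      (∀ i, D i ∈ V) ∧ (∀ i, D i (x i) = 1) ∧ (∀ i j, i ≠ j → D i (x j) = 0) ∧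
      ∀ T ∈ V, T = ∑ i, T (x i) • D i := by
  classical
  let ev (x : F) : Dual F V :=
    { toFun T := T.1 x
      map_add' _ _ := rfl
      map_smul' _ _ := rfl }
  have hspan : ⊤ ≤ Submodule.span F (Set.range ev) := by
    refine (Submodule.span_eq_top_of_ne_zero fun T hT => ?_).ge
    by_contra! h
    exact hT (Subtype.ext (LinearMap.ext fun x => h _ ⟨x, rfl⟩))
  let b := Basis.ofSpan hspan
  have hfin := FiniteDimensional.fintypeBasisIndex b
  have hb (i) : ∃ x, ev x = b i := Basis.ofSpan_subset hspan ⟨i, rfl⟩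
  choose x hx using hb
  let e := b.dualBasis.map (evalEquiv F V).symm
  have hbe (i j) : (e i).1 (x j) = if j = i then 1 else 0 := by
    change ev (x j) (e i) = _
    rw [hx, Basis.map_apply, apply_evalEquiv_symm_apply, Basis.dualBasis_apply_self]
  refine ⟨_, hfin, x, fun i => e i, fun i => (e i).2, fun i => by simp [hbe],
    fun i j hij => by simp [hbe, hij.symm], fun T hT => ?_⟩
  have hsum := congrArg Subtype.val (e.sum_repr ⟨T, hT⟩)
  simp only [Submodule.coe_sum, Submodule.coe_smul] at hsum
  have hcoef (j) : T (x j) = e.repr ⟨T, hT⟩ j := by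
    have := LinearMap.congr_fun hsum (x j)
    simpa [LinearMap.sum_apply, hbe] using this.symm
  simp only [hcoef, hsum]

lemma finiteDimensional_of_isDer (p : ℕ) [Fact p.Prime] [CharP F p]
    [FiniteDimensional (pthPowers F p) F] (V : Submodule F (Module.End ℤ F))
    (hV : ∀ D ∈ V, IsDer D) : FiniteDimensional F V := by
  let b := finBasis (pthPowers F p) F
  let f : V →ₗ[F] (Fin (finrank (pthPowers F p) F) → F) :=
    { toFun T i := T.1 (b i)
      map_add' _ _ := rfl
      map_smul' _ _ := rfl }
  refine Module.Finite.of_injective f ((injective_iff_map_eq_zero f).mpr fun T hT => ?_)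
  refine Subtype.ext (LinearMap.ext fun y => ?_)
  have hTb (i) : T.1 (b i) = 0 := congrFun hT i
  rw [← b.sum_repr y, map_sum]
  refine Finset.sum_eq_zero fun i _ => ?_
  rw [Subfield.smul_def, smul_eq_mul, hV T T.2, hTb, mul_zero,
    (hV T T.2).map_pthPowers (b.repr y i).2, zero_mul, add_zero]

lemma pow_apply_mul_pow {D : Module.End ℤ F} (hD : IsDer D) {c x : F} (hc : D c = 0)
    (hx : D x = 1) (n : ℕ) : (D ^ n) (c * x ^ n) = n.factorial * c := by
  have hmul {a : F} (ha : D a = 0) (z : F) : D (a * z) = a * D z := by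
    rw [hD, ha, zero_mul, zero_add]
  induction n generalizing c with
  | zero => simp
  | succ n ih =>
    have hcast : D (((n + 1 : ℕ) : F) * c) = 0 := by
      rw [← nsmul_eq_mul, map_nsmul, hc, smul_zero]
    rw [pow_succ, Module.End.mul_apply, hmul hc, hD.map_pow, hx, Nat.add_sub_cancel, mul_one,
      ← mul_assoc, mul_comm c, ih hcast, Nat.factorial_succ]
    push_cast
    ring

/-- Induction step for generating `F` over constants: if a derivation `T` kills `x`, where
`D x = 1`, and all constants of `D` in `K`, then it kills every `y ∈ K` with `D ^ n y = 0`
for some `n ≤ p`. -/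
lemma apply_eq_zero_of_pow_apply_eq_zero (p : ℕ) [Fact p.Prime] [CharP F p]
    {D T : Module.End ℤ F} (hD : IsDer D) (hT : IsDer T) (K : Subfield F)
    (hK : ∀ y ∈ K, D y ∈ K) {x : F} (hxK : x ∈ K) (hx : D x = 1) (hTx : T x = 0)
    (hconst : ∀ y ∈ K, D y = 0 → T y = 0) {n : ℕ} (hn : n ≤ p) {y : F} (hy : y ∈ K)
    (hny : (D ^ n) y = 0) : T y = 0 := by
  induction n generalizing y with
  | zero =>
    have : y = 0 := by simpa using hny
    rw [this, map_zero]
  | succ n ih =>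
    have hfac : (n.factorial : F) ≠ 0 := by
      rw [Ne, CharP.cast_eq_zero_iff F p, (Fact.out : p.Prime).dvd_factorial]
      omega
    have hpowK (k : ℕ) : (D ^ k) y ∈ K := by
      induction k with
      | zero => simpa using hy
      | succ k ihk =>
        rw [pow_succ', Module.End.mul_apply]
        exact hK _ ihk
    have hfacD : D ((n.factorial : F)⁻¹) = 0 := by
      refine hD.map_inv ?_
      rw [← nsmul_one, map_nsmul, hD.map_one, smul_zero]
    set c := (n.factorial : F)⁻¹ * (D ^ n) y with hc
    have hcK : c ∈ K := K.mul_mem (K.inv_mem (natCast_mem K _)) (hpowK n)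
    have hDc : D c = 0 := by
      rw [hc, hD, hfacD, ← Module.End.mul_apply, ← pow_succ', hny, zero_mul, mul_zero, add_zero]
    have hrest := ih (by omega) (K.sub_mem hy (K.mul_mem hcK (K.pow_mem hxK n))) (by
      rw [map_sub, pow_apply_mul_pow hD hDc hx, hc, mul_inv_cancel_left₀ hfac, sub_self])
    rw [map_sub, hT, hconst c hcK hDc, hT.map_pow, hTx] at hrest
    simpa using hrest

/-- A derivation killing the common constants of commuting derivations `D i` with `D i ^ p = 0`
and the elements of a dual family vanishes. -/
lemma eq_zero_of_dual_family (p : ℕ) [Fact p.Prime] [CharP F p] {ι : Type*} [Fintype ι]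
    {x : ι → F} {D : ι → Module.End ℤ F} (hD : ∀ i, IsDer (D i)) (hone : ∀ i, D i (x i) = 1)
    (hzero : ∀ i j, i ≠ j → D i (x j) = 0) (hcomm : ∀ i j, Commute (D i) (D j))
    (hpow : ∀ i, D i ^ p = 0) {T : Module.End ℤ F} (hT : IsDer T) (hTx : ∀ i, T (x i) = 0)
    (hTc : ∀ y, (∀ i, D i y = 0) → T y = 0) : T = 0 := by
  classical
  suffices H : ∀ s : Finset ι, ∀ y, (∀ i ∉ s, D i y = 0) → T y = 0 from
    LinearMap.ext fun y => H Finset.univ y fun i hi => absurd (Finset.mem_univ i) hi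
  intro s
  induction s using Finset.induction_on with
  | empty => exact fun y hy => hTc y fun i => hy i (Finset.notMem_empty i)
  | insert j s _ ih =>
    intro y hy
    let K := fixedSubfield {T | ∃ i ∉ insert j s, D i = T} (by rintro _ ⟨i, _, rfl⟩; exact hD i)
    have memK {z : F} : z ∈ K ↔ ∀ i ∉ insert j s, D i z = 0 :=
      ⟨fun h i hi => h _ ⟨i, hi, rfl⟩, by rintro h _ ⟨i, hi, rfl⟩; exact h i hi⟩
    refine apply_eq_zero_of_pow_apply_eq_zero p (hD j) hT K (fun z hz => ?_) ?_ (hone j) (hTx j)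
      (fun z hz hjz => ih z fun i hi => ?_) le_rfl (memK.mpr hy) (by rw [hpow]; rfl)
    · rw [memK] at hz ⊢
      intro i hi
      rw [← Module.End.mul_apply, (hcomm i j).eq, Module.End.mul_apply, hz i hi, map_zero]
    · exact memK.mpr fun i hi => hzero i j fun h => hi (h ▸ Finset.mem_insert_self j s)
    · rcases eq_or_ne i j with rfl | hij
      · exact hjz
      · exact memK.mp hz i (by simp [hij, hi])

lemma derOver_fixedSubfield (p : ℕ) [Fact p.Prime] [CharP F p]
    [FiniteDimensional (pthPowers F p) F] {S : Set (Module.End ℤ F)}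
    (hS : IsRestrictedSubalgebra F p S) : DerOver (fixedSubfield S hS.1) = S := by
  obtain ⟨hder, h0, hadd, hsmul, hlie, hp⟩ := hS
  refine Set.Subset.antisymm (fun T hT => ?_) fun T hT => ⟨hder T hT, fun e he => he T hT⟩
  let V : Submodule F (Module.End ℤ F) :=
    { carrier := S
      zero_mem' := h0
      add_mem' := fun ha hb => hadd _ ha _ hb
      smul_mem' := hsmul }
  have hfin := finiteDimensional_of_isDer p V hder
  obtain ⟨ι, _, x, D, hDV, hone, hzero, hexp⟩ := exists_dual_family V
  have hvanish {U : Module.End ℤ F} (hU : U ∈ S) (h : ∀ i, U (x i) = 0) : U = 0 := by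
    rw [hexp U hU]
    simp [h]
  have hconst (i j) : D i (x j) = 0 ∨ D i (x j) = 1 := by
    rcases eq_or_ne i j with rfl | hij
    · exact .inr (hone i)
    · exact .inl (hzero i j hij)
  have hkill (i j k) : D i (D j (x k)) = 0 := by
    rcases hconst j k with h | h <;> rw [h]
    · exact map_zero _
    · exact (hder _ (hDV i)).map_one
  have hcomm (i j) : Commute (D i) (D j) := by
    rw [commute_iff_lie_eq]
    refine hvanish (hlie _ (hDV i) _ (hDV j)) fun k => ?_
    rw [Ring.lie_def, LinearMap.sub_apply, Module.End.mul_apply, Module.End.mul_apply, hkill,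
      hkill, sub_self]
  have hpow (i) : D i ^ p = 0 := by
    refine hvanish (hp _ (hDV i)) fun k => ?_
    obtain ⟨n, hn⟩ := Nat.exists_eq_add_of_le' (Fact.out : p.Prime).two_le
    rw [hn, pow_add, Module.End.mul_apply, pow_two, Module.End.mul_apply, hkill, map_zero]
  have hW : ∑ i, T (x i) • D i ∈ V := V.sum_mem fun i _ => V.smul_mem _ (hDV i)
  have hTW : T + (-1 : F) • ∑ i, T (x i) • D i = 0 := by
    refine eq_zero_of_dual_family p (fun i => hder _ (hDV i)) hone hzero hcomm hpow
      (hT.1.add ((hder _ hW).smul _)) (fun j => ?_) fun y hy => ?_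
    · have hsum : (∑ i, T (x i) • D i) (x j) = T (x j) := by
        rw [LinearMap.sum_apply, Finset.sum_eq_single j]
        · simp [hone]
        · intro i _ hij
          simp [hzero i j hij]
        · simp
      simp [hsum]
    · have hy' : y ∈ fixedSubfield S hder := fun U hU => by
        rw [hexp U hU]
        simp [LinearMap.sum_apply, hy]
      rw [LinearMap.add_apply, LinearMap.smul_apply, hT.2 y hy', hy' _ hW, smul_zero, add_zero]
  rw [neg_one_smul, add_neg_eq_zero] at hTW
  rw [hTW]
  exact hW

end Correspondence

/-- Jacobson's bijective correspondence between the inseparable subextensions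
`F^p ⊆ E ⊆ F` of exponent `1` and the restricted subalgebras of `Der(F)`. -/
theorem jacobson_exponent_one_correspondence
    (F : Type*) [Field F] (p : ℕ) [Fact p.Prime] [CharP F p]
    [FiniteDimensional ↥(pthPowers F p) F] :
    -- `E ↦ Der_E(F)` lands in restricted subalgebras
    (∀ E : Subfield F, pthPowers F p ≤ E → IsRestrictedSubalgebra F p (DerOver E)) ∧
    -- `L ↦ E_L` is a left inverse:  `E_{Der_E(F)} = E`
    (∀ E : Subfield F, pthPowers F p ≤ E → fixedSet (DerOver E) = (E : Set F)) ∧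
    -- `L ↦ E_L` lands in intermediate fields, and `E ↦ Der_E(F)` is a right inverse:
    -- every restricted subalgebra is `Der_E(F)` for the intermediate field `E = E_L`
    (∀ S : Set (Module.End ℤ F), IsRestrictedSubalgebra F p S →
      ∃ E : Subfield F, pthPowers F p ≤ E ∧ (E : Set F) = fixedSet S ∧ DerOver E = S) := by
  exact ⟨fun E _ => isRestrictedSubalgebra_derOver p E, fun E hE => fixedSet_derOver p hE,
    fun S hS => ⟨fixedSubfield S hS.1, fun a ha D hD => (hS.1 D hD).map_pthPowers ha, rfl,
      derOver_fixedSubfield p hS⟩⟩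
end

section
/- Let F be a field of characteristic p > 0 and n ≥ 3. The Special Lie algebra S(n), defined as the derived subalgebra of Ŝ(n) = { D ∈ W(n) : D·ω_S = 0 } where ω_S = dx_1 ∧ ⋯ ∧ dx_n, has F-dimension (n−1)(p^n − 1) and is spanned over F by the elements D_{ij}(x^a) for monomials x^a ∈ A(n) and 1 ≤ i < j ≤ n, where D_{ij}(f) = D_j(f)D_i − D_i(f)D_j. -/
/-!
STATEMENT 5: for a field `F` of characteristic `p > 0` and `n ≥ 3`, the Special algebra
`S(n)`, the derived subalgebra of `Ŝ(n) = {D ∈ W(n) | D·ω_S = 0}` with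
`ω_S = dx₁ ∧ ⋯ ∧ dxₙ`, has `F`-dimension `(n-1)(pⁿ-1)` and is spanned by the elements
`D_{ij}(x^a)`, `x^a` a monomial of `A(n)`, `1 ≤ i < j ≤ n`, where
`D_{ij}(f) = D_j(f)·D_i − D_i(f)·D_j`.

Since `W(n)` is a free `A(n)`-module with basis `D₁,…,Dₙ` (dual to `dx₁,…,dxₙ`), the
`n`-form `ω_S` is realized as the alternating `A(n)`-multilinear function on vector
fields `ω_S(E₁,…,Eₙ) = det (E_i(x_j))`, and the condition `D·ω_S = 0` is the vanishing
of the Lie derivative: `D (ω_S(E₁,…,Eₙ)) = ∑_i ω_S(E₁,…,⁅D,E_i⁆,…,Eₙ)` for all `E_i`.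
-/

set_option maxHeartbeats 1000000
set_option synthInstance.maxHeartbeats 400000

noncomputable section

def truncIdeal (F : Type*) [Field F] (p n : ℕ) : Ideal (MvPolynomial (Fin n) F) :=
  Ideal.span (Set.range fun i : Fin n => MvPolynomial.X i ^ p)

/-- `A(n) = F[x₁,…,xₙ]/(x₁^p,…,xₙ^p)`. -/
abbrev TruncPoly (F : Type*) [Field F] (p n : ℕ) :=
  MvPolynomial (Fin n) F ⧸ truncIdeal F p n

/-- `W(n) = Der_F (A(n))`. -/
abbrev WittJacobson (F : Type*) [Field F] (p n : ℕ) :=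
  Derivation F (TruncPoly F p n) (TruncPoly F p n)

def xcl (F : Type*) [Field F] (p n : ℕ) (i : Fin n) : TruncPoly F p n :=
  Ideal.Quotient.mk _ (MvPolynomial.X i)

/-- The volume form `ω_S = dx₁ ∧ ⋯ ∧ dxₙ`, evaluated on `n` vector fields. -/
def omegaS (F : Type*) [Field F] (p n : ℕ) (E : Fin n → WittJacobson F p n) :
    TruncPoly F p n :=
  (Matrix.of fun i j => E i (xcl F p n j)).det

/-- `Ŝ(n) = {D ∈ W(n) | D·ω_S = 0}` (vanishing of the Lie derivative of `ω_S`). -/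
def SpecialHat (F : Type*) [Field F] (p n : ℕ) : Set (WittJacobson F p n) :=
  {D | ∀ E : Fin n → WittJacobson F p n,
    D (omegaS F p n E) = ∑ i, omegaS F p n (Function.update E i ⁅D, E i⁆)}

/-- The span of all brackets of elements of `S` (the derived subalgebra of `S`). -/
def bracketSpan (F : Type*) [Field F] (p n : ℕ) (S : Set (WittJacobson F p n)) :
    Submodule F (WittJacobson F p n) :=
  Submodule.span F {z | ∃ D ∈ S, ∃ E ∈ S, z = ⁅D, E⁆}

/-- The Special algebra `S(n) = [Ŝ(n), Ŝ(n)]`. -/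
def Special (F : Type*) [Field F] (p n : ℕ) : Submodule F (WittJacobson F p n) :=
  bracketSpan F p n (SpecialHat F p n)

/-- `D_{ij}(f) = D_j(f)·D_i − D_i(f)·D_j`. -/
def Dij (F : Type*) [Field F] (p n : ℕ) (Dj : Fin n → WittJacobson F p n)
    (i j : Fin n) (f : TruncPoly F p n) : WittJacobson F p n :=
  Dj j f • Dj i - Dj i f • Dj j

section Determinant

variable {R A : Type*} [CommRing R] [CommRing A] [Algebra R A]

theorem Derivation.map_prod_univ {ι : Type*} [Fintype ι] [DecidableEq ι] (D : Derivation R A A)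
    (f : ι → A) : D (∏ i, f i) = ∑ i, ∏ k, Function.update f i (D (f i)) k := by
  have key : ∀ s : Finset ι,
      D (∏ i ∈ s, f i) = ∑ i ∈ s, ∏ k ∈ s, Function.update f i (D (f i)) k := by
    intro s
    induction s using Finset.induction_on with
    | empty => simp
    | insert a s ha ih =>
      rw [Finset.prod_insert ha, D.leibniz, ih, Finset.sum_insert ha, Finset.prod_insert ha,
        Function.update_self, Finset.prod_update_of_notMem ha, add_comm, smul_eq_mul, smul_eq_mul,
        mul_comm, Finset.mul_sum]
      congr 1
      refine Finset.sum_congr rfl fun i hi => ?_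
      rw [Finset.prod_insert ha, Function.update_of_ne (by rintro rfl; exact ha hi)]
  exact key Finset.univ

theorem Derivation.map_det {ι : Type*} [Fintype ι] [DecidableEq ι] (D : Derivation R A A)
    (M : Matrix ι ι A) : D M.det = ∑ i, (M.updateRow i fun j => D (M i j)).det := by
  have hrow : ∀ N : Matrix ι ι A, N.det = ∑ σ : Equiv.Perm ι, σ.sign • ∏ i, N i (σ i) := by
    intro N
    rw [← Matrix.det_transpose, Matrix.det_apply]
    rfl
  simp_rw [hrow]
  rw [Finset.sum_comm, map_sum]
  refine Finset.sum_congr rfl fun σ _ => ?_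
  rw [Units.smul_def, map_zsmul, D.map_prod_univ, ← Finset.smul_sum]
  congr 1
  refine Finset.sum_congr rfl fun i _ => Finset.prod_congr rfl fun k _ => ?_
  rcases eq_or_ne k i with rfl | h
  · simp
  · simp [h]

theorem Matrix.sum_det_updateRow_mul {ι : Type*} [Fintype ι] [DecidableEq ι]
    (M J : Matrix ι ι A) : ∑ i, (M.updateRow i ((M * J) i)).det = J.trace * M.det := by
  calc ∑ i, (M.updateRow i ((M * J) i)).det
      = (M * J * M.adjugate).trace := by
        refine Finset.sum_congr rfl fun i _ => ?_
        rw [← Matrix.cramer_transpose_apply, Matrix.cramer_eq_adjugate_mulVec,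
          ← Matrix.adjugate_transpose, Matrix.mulVec_transpose, Matrix.diag_apply,
          Matrix.mul_apply_eq_vecMul]
        rfl
    _ = J.trace * M.det := by
        rw [Matrix.trace_mul_comm, ← Matrix.mul_assoc, Matrix.adjugate_mul, Matrix.smul_mul,
          Matrix.one_mul, Matrix.trace_smul, smul_eq_mul, mul_comm]

end Determinant

section TruncatedCoordinates

variable {F A : Type*} [Field F] [CommRing A] [Algebra F A] {p n : ℕ}

/-- The exponent vector of a reduced monomial. -/
def expVec (b : Fin n → Fin p) : Fin n →₀ ℕ :=
  Finsupp.equivFunOnFinite.symm fun i => (b i : ℕ)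

@[simp]
theorem expVec_apply (b : Fin n → Fin p) (i : Fin n) : expVec b i = b i := rfl

theorem expVec_injective : Function.Injective (expVec : (Fin n → Fin p) → Fin n →₀ ℕ) := by
  intro b c h
  ext i
  exact congr($h i)

theorem exists_expVec {s : Fin n →₀ ℕ} (h : ∀ i, s i < p) : ∃ b : Fin n → Fin p, expVec b = s :=
  ⟨fun i => ⟨s i, h i⟩, by ext; rfl⟩

/-- The monomial `x^s`. -/
def monomialAt (x : Fin n → A) (s : Fin n →₀ ℕ) : A := ∏ k, x k ^ s k

theorem monomialAt_mul (x : Fin n → A) (s t : Fin n →₀ ℕ) :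
    monomialAt x s * monomialAt x t = monomialAt x (s + t) := by
  simp [monomialAt, ← Finset.prod_mul_distrib, pow_add]

/-- `d_{ij}(f) = d_j(f)·d_i − d_i(f)·d_j`. -/
def dij (d : Fin n → Derivation F A A) (i j : Fin n) (f : A) : Derivation F A A :=
  d j f • d i - d i f • d j

theorem dij_add (d : Fin n → Derivation F A A) (i j : Fin n) (f g : A) :
    dij d i j (f + g) = dij d i j f + dij d i j g := by
  simp only [dij, map_add, add_smul]
  abel

theorem dij_smul (d : Fin n → Derivation F A A) (i j : Fin n) (c : F) (f : A) :
    dij d i j (c • f) = c • dij d i j f := by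
  simp only [dij, Derivation.map_smul, smul_assoc, smul_sub]

theorem dij_swap (d : Fin n → Derivation F A A) (i j : Fin n) (f : A) :
    dij d i j f = -dij d j i f := by
  simp [dij]

@[simp]
theorem dij_zero (d : Fin n → Derivation F A A) (i j : Fin n) : dij d i j 0 = 0 := by
  simp [dij]

/-- The span of the fields `d_{ij}(x^a)` with `i < j` and `x^a` reduced. -/
def spanDij (p : ℕ) (x : Fin n → A) (d : Fin n → Derivation F A A) :
    Submodule F (Derivation F A A) :=
  Submodule.span F {z | ∃ i j : Fin n, i < j ∧ ∃ a : Fin n → Fin p,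
    z = dij d i j (∏ k, x k ^ (a k : ℕ))}

/-- The divergence of a vector field. -/
def divergence (x : Fin n → A) (d : Fin n → Derivation F A A) : Derivation F A A →ₗ[F] A where
  toFun D := ∑ i, d i (D (x i))
  map_add' D E := by simp [Finset.sum_add_distrib]
  map_smul' c D := by simp [Finset.smul_sum]

theorem divergence_apply (x : Fin n → A) (d : Fin n → Derivation F A A) (D : Derivation F A A) :
    divergence x d D = ∑ i, d i (D (x i)) := rfl

/-- The volume form `dx₁ ∧ ⋯ ∧ dxₙ`, evaluated on `n` vector fields. -/
def volumeForm (x : Fin n → A) (E : Fin n → Derivation F A A) : A :=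
  (Matrix.of fun i j => E i (x j)).det

/-- The vector fields annihilating the volume form. -/
def volumePreserving (F : Type*) [Field F] [Algebra F A] (x : Fin n → A) :
    Set (Derivation F A A) :=
  {D | ∀ E : Fin n → Derivation F A A,
    D (volumeForm x E) = ∑ i, volumeForm x (Function.update E i ⁅D, E i⁆)}

/-- The span of all brackets of elements of `S`. -/
def lieSpan (S : Set (Derivation F A A)) : Submodule F (Derivation F A A) :=
  Submodule.span F {z | ∃ D ∈ S, ∃ E ∈ S, z = ⁅D, E⁆}

theorem derivation_sum_apply {ι : Type*} (s : Finset ι) (D : ι → Derivation F A A)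
    (f : A) : (∑ i ∈ s, D i) f = ∑ i ∈ s, D i f := by
  induction s using Finset.cons_induction with
  | empty => simp
  | cons a s ha ih => simp [Finset.sum_cons, ih]

/-- Evaluation at the `i`-th coordinate function, as a linear map. -/
def evalAt (x : Fin n → A) (i : Fin n) : Derivation F A A →ₗ[F] A where
  toFun D := D (x i)
  map_add' _ _ := rfl
  map_smul' _ _ := rfl

@[simp]
theorem evalAt_apply (x : Fin n → A) (i : Fin n) (D : Derivation F A A) :
    evalAt x i D = D (x i) := rfl

theorem cast_ne_zero_of_lt [CharP F p] {m : ℕ} (h0 : m ≠ 0) (h : m < p) : (m : F) ≠ 0 := by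
  rw [Ne, CharP.cast_eq_zero_iff F p]
  exact Nat.not_dvd_of_pos_of_lt (Nat.pos_of_ne_zero h0) h

section Exponents

variable [NeZero p]

/-- The exponent of the top monomial `∏ x_k^{p-1}`. -/
def cornerExp (n p : ℕ) [NeZero p] : Fin n → Fin p :=
  fun _ => ⟨p - 1, Nat.sub_one_lt (NeZero.ne p)⟩

/-- The exponent of the monomial `∏_{k ≠ i} x_k^{p-1}`. -/
def faceExp (n p : ℕ) [NeZero p] (i : Fin n) : Fin n → Fin p :=
  Function.update (cornerExp n p) i ⟨0, NeZero.pos p⟩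

theorem faceExp_self (i : Fin n) : (faceExp n p i i : ℕ) = 0 := by simp [faceExp]

theorem faceExp_of_ne {i j : Fin n} (h : j ≠ i) : (faceExp n p i j : ℕ) = p - 1 := by
  simp [faceExp, cornerExp, h]

theorem exists_lt_of_ne_cornerExp {b : Fin n → Fin p} (hb : b ≠ cornerExp n p) :
    ∃ i, (b i : ℕ) + 1 < p := by
  by_contra! h
  refine hb (funext fun i => Fin.ext ?_)
  have := h i
  have := (b i).isLt
  simp only [cornerExp]
  omega

/-- A direction in which the monomial with the given exponent can be integrated. -/
def freeIndex (b : {b : Fin n → Fin p // b ≠ cornerExp n p}) : Fin n :=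
  (exists_lt_of_ne_cornerExp b.2).choose

theorem freeIndex_spec (b : {b : Fin n → Fin p // b ≠ cornerExp n p}) :
    (b.1 (freeIndex b) : ℕ) + 1 < p :=
  (exists_lt_of_ne_cornerExp b.2).choose_spec

/-- The linear conditions cutting the span of the `d_{ij}(x^a)` out of all derivations: the
coefficients of the divergence, and the coefficient of `∏_{k ≠ i} x_k^{p-1}` in the `i`-th component. -/
def constraintMap (x : Fin n → A) (e : A ≃ₗ[F] ((Fin n → Fin p) → F))
    (d : Fin n → Derivation F A A) :
    Derivation F A A →ₗ[F] ({b : Fin n → Fin p // b ≠ cornerExp n p} ⊕ Fin n → F) :=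
  LinearMap.pi (Sum.elim
    (fun b => LinearMap.proj b.1 ∘ₗ e.toLinearMap ∘ₗ divergence x d)
    (fun i => LinearMap.proj (faceExp n p i) ∘ₗ e.toLinearMap ∘ₗ evalAt x i))

@[simp]
theorem constraintMap_inl (x : Fin n → A) (e : A ≃ₗ[F] ((Fin n → Fin p) → F))
    (d : Fin n → Derivation F A A) (D : Derivation F A A)
    (b : {b : Fin n → Fin p // b ≠ cornerExp n p}) :
    constraintMap x e d D (Sum.inl b) = e (divergence x d D) b := rfl

@[simp]
theorem constraintMap_inr (x : Fin n → A) (e : A ≃ₗ[F] ((Fin n → Fin p) → F))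
    (d : Fin n → Derivation F A A) (D : Derivation F A A) (i : Fin n) :
    constraintMap x e d D (Sum.inr i) = e (D (x i)) (faceExp n p i) := rfl

/-- A basis of a complement of the span of the `d_{ij}(x^a)`, dual to `constraintMap`. -/
def complementVec (x : Fin n → A) (d : Fin n → Derivation F A A) :
    {b : Fin n → Fin p // b ≠ cornerExp n p} ⊕ Fin n → Derivation F A A :=
  Sum.elim
    (fun b => ((b.1 (freeIndex b) + 1 : ℕ) : F)⁻¹ •
      monomialAt x (expVec b.1 + Finsupp.single (freeIndex b) 1) • d (freeIndex b))
    (fun i => monomialAt x (expVec (faceExp n p i)) • d i)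

end Exponents

section Dual

variable {x : Fin n → A} {d : Fin n → Derivation F A A}
  (hd : ∀ j i, d j (x i) = if i = j then 1 else 0)

include hd

theorem partial_monomialAt (j : Fin n) (s : Fin n →₀ ℕ) :
    d j (monomialAt x s) = (s j : F) • monomialAt x (s - Finsupp.single j 1) := by
  rw [monomialAt, Derivation.map_prod_univ, Finset.sum_eq_single j]
  · rw [Derivation.leibniz_pow, hd, if_pos rfl, Finset.prod_update_of_mem (Finset.mem_univ j),
      monomialAt, ← Finset.mul_prod_erase _ _ (Finset.mem_univ j)]
    have : ∏ k ∈ Finset.univ.erase j, x k ^ (s - Finsupp.single j 1 : Fin n →₀ ℕ) k =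
        ∏ k ∈ Finset.univ \ {j}, x k ^ s k := by
      rw [← Finset.erase_eq]
      refine Finset.prod_congr rfl fun k hk => ?_
      rw [Finsupp.tsub_apply, Finsupp.single_eq_of_ne (Finset.ne_of_mem_erase hk), tsub_zero]
    rw [this, Nat.cast_smul_eq_nsmul]
    simp [mul_assoc]
  · intro i _ hi
    rw [Derivation.leibniz_pow, hd, if_neg hi, Finset.prod_update_of_mem (Finset.mem_univ i)]
    simp
  · simp

theorem divergence_smul_partial (f : A) (i : Fin n) : divergence x d (f • d i) = d i f := by
  rw [divergence_apply, Finset.sum_eq_single i]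
  · simp [hd]
  · intro k _ hk
    simp [hd, hk]
  · simp

theorem dij_apply_gen (i j m : Fin n) (f : A) :
    dij d i j f (x m) = (if m = i then d j f else 0) - if m = j then d i f else 0 := by
  simp [dij, hd]

end Dual

variable {x : Fin n → A} {e : A ≃ₗ[F] ((Fin n → Fin p) → F)}
  (he : ∀ s b, e (monomialAt x s) b = if s = expVec b then 1 else 0)
  {d : Fin n → Derivation F A A} (hd : ∀ j i, d j (x i) = if i = j then 1 else 0)

section Coord

include he

theorem span_monomialAt : Submodule.span F (Set.range (monomialAt x)) = ⊤ := by
  rw [eq_top_iff]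
  rintro f -
  have : f = ∑ b, e f b • monomialAt x (expVec b) := by
    apply e.injective
    ext b
    simp [he, expVec_injective.eq_iff]
  rw [this]
  exact sum_mem fun b _ => Submodule.smul_mem _ _ (Submodule.subset_span (Set.mem_range_self _))

theorem monomialAt_eq_zero {s : Fin n →₀ ℕ} {i : Fin n} (h : p ≤ s i) : monomialAt x s = 0 := by
  apply e.injective
  ext b
  rw [he, if_neg]
  · simp
  · rintro rfl
    exact h.not_gt (b i).isLt

theorem derivation_ext_of_coord {D E : Derivation F A A} (h : ∀ i, D (x i) = E (x i)) :
    D = E := by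
  have hmon : ∀ s, D (monomialAt x s) = E (monomialAt x s) := by
    intro s
    simp only [monomialAt, Derivation.map_prod_univ, Derivation.leibniz_pow, h]
  ext f
  have hf : f ∈ Submodule.span F (Set.range (monomialAt x)) :=
    span_monomialAt he ▸ Submodule.mem_top
  exact LinearMap.eqOn_span (f := (D : A →ₗ[F] A)) (g := E)
    (by rintro _ ⟨s, rfl⟩; exact hmon s) hf

theorem dij_mem_spanDij (i j : Fin n) (f : A) : dij d i j f ∈ spanDij p x d := by
  wlog hij : i < j generalizing i j
  · rcases (not_lt.mp hij).eq_or_lt with rfl | h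
    · simp [dij]
    · rw [dij_swap]
      exact neg_mem (this _ _ h)
  have hf : f ∈ Submodule.span F (Set.range (monomialAt x)) :=
    span_monomialAt he ▸ Submodule.mem_top
  induction hf using Submodule.span_induction with
  | mem f hf =>
    obtain ⟨s, rfl⟩ := hf
    by_cases hs : ∀ k, s k < p
    · obtain ⟨a, rfl⟩ := exists_expVec hs
      exact Submodule.subset_span ⟨i, j, hij, a, rfl⟩
    · push Not at hs
      obtain ⟨k, hk⟩ := hs
      simp [monomialAt_eq_zero he hk]
  | zero => simp
  | add f g _ _ hf hg =>
    rw [dij_add]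
    exact add_mem hf hg
  | smul c f _ hf =>
    rw [dij_smul]
    exact Submodule.smul_mem _ c hf

end Coord

include he hd

theorem eq_sum_smul_partial (D : Derivation F A A) : D = ∑ k, D (x k) • d k := by
  refine derivation_ext_of_coord he fun i => ?_
  simp [derivation_sum_apply, hd]

theorem apply_eq_sum_partial (D : Derivation F A A) (f : A) :
    D f = ∑ k, D (x k) * d k f := by
  conv_lhs => rw [eq_sum_smul_partial he hd D]
  simp [derivation_sum_apply]

theorem partial_comm (i j : Fin n) (f : A) :
    d i (d j f) = d j (d i f) := by
  have h : ⁅d i, d j⁆ = 0 := by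
    refine derivation_ext_of_coord he fun k => ?_
    rw [Derivation.commutator_apply, hd, hd]
    split_ifs <;> simp
  rw [← sub_eq_zero, ← Derivation.commutator_apply, h, Derivation.zero_apply]

theorem sum_volumeForm_update (D : Derivation F A A) (E : Fin n → Derivation F A A) :
    ∑ i, volumeForm x (Function.update E i ⁅D, E i⁆) =
      D (volumeForm x E) - divergence x d D * volumeForm x E := by
  set M : Matrix (Fin n) (Fin n) A := Matrix.of fun i j => E i (x j)
    with hM
  let J : Matrix (Fin n) (Fin n) A := Matrix.of fun k j => d k (D (x j))
  have htr : divergence x d D = J.trace := divergence_apply x d D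
  have hrow : ∀ i, volumeForm x (Function.update E i ⁅D, E i⁆) =
      (M.updateRow i fun j => D (M i j)).det - (M.updateRow i ((M * J) i)).det := by
    intro i
    simp only [← Matrix.cramer_transpose_apply]
    rw [← Pi.sub_apply, ← map_sub, Matrix.cramer_transpose_apply, volumeForm]
    congr 1
    ext k j
    rcases eq_or_ne k i with rfl | hk
    · simp [hM, J, Derivation.commutator_apply, Matrix.mul_apply,
        apply_eq_sum_partial he hd (E k) (D _)]
    · simp [hM, hk]
  have hE : volumeForm x E = M.det := rfl
  rw [Finset.sum_congr rfl fun i _ => hrow i, Finset.sum_sub_distrib, ← D.map_det,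
    Matrix.sum_det_updateRow_mul, htr, hE]

theorem mem_volumePreserving_iff {D : Derivation F A A} :
    D ∈ volumePreserving F x ↔ divergence x d D = 0 := by
  constructor
  · intro h
    have h1 : volumeForm x d = 1 := by
      rw [volumeForm, ← Matrix.det_one (n := Fin n)]
      congr 1
      ext i j
      simp [hd, Matrix.one_apply, eq_comm]
    have := h d
    rw [sum_volumeForm_update he hd, h1] at this
    simpa using this
  · intro h E
    rw [sum_volumeForm_update he hd, h, zero_mul, sub_zero]

theorem divergence_dij (i j : Fin n) (f : A) :
    divergence x d (dij d i j f) = 0 := by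
  rw [divergence_apply]
  simp only [dij_apply_gen hd, map_sub, Finset.sum_sub_distrib, apply_ite (d _), map_zero,
    Finset.sum_ite_eq', Finset.mem_univ, if_true]
  rw [partial_comm he hd, sub_self]

theorem lie_eq_sum_dij {D E : Derivation F A A} (hD : divergence x d D = 0)
    (hE : divergence x d E = 0) :
    ⁅D, E⁆ = ∑ i, ∑ j, dij d i j (D (x j) * E (x i)) := by
  refine derivation_ext_of_coord he fun m => ?_
  rw [divergence_apply] at hD hE
  simp only [derivation_sum_apply, dij_apply_gen hd, Finset.sum_sub_distrib,
    Finset.sum_ite_eq, Finset.mem_univ, if_true]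
  rw [Finset.sum_comm]
  simp only [Finset.sum_ite_eq, Finset.mem_univ, if_true, Derivation.leibniz, smul_eq_mul,
    Finset.sum_add_distrib, ← Finset.mul_sum, hD, hE, mul_zero, zero_add, add_zero]
  rw [Derivation.commutator_apply, apply_eq_sum_partial he hd D (E _),
    apply_eq_sum_partial he hd E (D _)]

/-- For `d_i f = 0 = d_j g`, the field `d_{ij}(f g)` is a bracket. -/
theorem dij_mul_eq_lie {i j : Fin n} {f g : A} (hf : d i f = 0) (hg : d j g = 0) :
    dij d i j (f * g) = ⁅g • d j, f • d i⁆ := by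
  refine derivation_ext_of_coord he fun m => ?_
  simp only [dij_apply_gen hd, Derivation.commutator_apply, Derivation.smul_apply, hd,
    Derivation.leibniz, hf, hg, smul_eq_mul]
  split_ifs <;> simp

theorem dij_monomialAt_mem_lieSpan {i j : Fin n} (hij : i ≠ j) (s : Fin n →₀ ℕ) :
    dij d i j (monomialAt x s) ∈ lieSpan (volumePreserving F x) := by
  have hf : d i (monomialAt x (s.erase i)) = 0 := by simp [partial_monomialAt hd]
  have hg : d j (monomialAt x (Finsupp.single i (s i))) = 0 := by simp [partial_monomialAt hd, hij]
  rw [← Finsupp.erase_add_single i s, ← monomialAt_mul, dij_mul_eq_lie he hd hf hg]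
  refine Submodule.subset_span ⟨_, ?_, _, ?_, rfl⟩
  · rw [mem_volumePreserving_iff he hd, divergence_smul_partial hd, hg]
  · rw [mem_volumePreserving_iff he hd, divergence_smul_partial hd, hf]

theorem lieSpan_eq_spanDij : lieSpan (volumePreserving F x) = spanDij p x d := by
  refine le_antisymm (Submodule.span_le.mpr ?_) (Submodule.span_le.mpr ?_)
  · rintro _ ⟨D, hD, E, hE, rfl⟩
    rw [mem_volumePreserving_iff he hd] at hD hE
    rw [lie_eq_sum_dij he hd hD hE]
    exact sum_mem fun i _ => sum_mem fun j _ => dij_mem_spanDij he i j _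
  · rintro _ ⟨i, j, hij, a, rfl⟩
    have := dij_monomialAt_mem_lieSpan he hd hij.ne (expVec a)
    exact this

theorem finrank_derivation :
    Module.Finite F (Derivation F A A) ∧ Module.finrank F (Derivation F A A) = n * p ^ n := by
  let e' : Derivation F A A ≃ₗ[F] (Fin n → (Fin n → Fin p) → F) :=
    LinearEquiv.ofBijective (LinearMap.pi fun i => e.toLinearMap ∘ₗ evalAt x i)
      ⟨fun D E h => derivation_ext_of_coord he fun i => e.injective congr($h i),
      fun v => ⟨∑ i, e.symm (v i) • d i, by
        ext1 i
        simp [hd, apply_ite e]⟩⟩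
  exact ⟨Module.Finite.equiv e'.symm, by simp [e'.finrank_eq, Module.finrank_pi_fintype]⟩

section Prime

variable [NeZero p] [CharP F p]

theorem coord_partial_eq_zero {j : Fin n} {b : Fin n → Fin p} (hb : (b j : ℕ) = p - 1)
    (f : A) : e (d j f) b = 0 := by
  have hf : f ∈ Submodule.span F (Set.range (monomialAt x)) :=
    span_monomialAt he ▸ Submodule.mem_top
  induction hf using Submodule.span_induction with
  | mem f hf =>
    obtain ⟨s, rfl⟩ := hf
    rw [partial_monomialAt hd, map_smul, Pi.smul_apply, he]
    split_ifs with h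
    · have hj := congr($h j)
      simp only [Finsupp.tsub_apply, Finsupp.single_eq_same, expVec_apply, hb] at hj
      have hp := NeZero.pos p
      rcases Nat.eq_zero_or_pos (s j) with h0 | h0
      · simp [h0]
      · rw [show s j = p by omega, CharP.cast_eq_zero, zero_smul]
    · simp
  | zero => simp
  | add f g _ _ hf hg => simp [hf, hg]
  | smul c f _ hf => simp [hf]

theorem constraintMap_dij (i j : Fin n) (f : A) :
    constraintMap x e d (dij d i j f) = 0 := by
  rcases eq_or_ne i j with rfl | hij
  · simp [dij]
  ext (b | m)
  · simp [divergence_dij he hd]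
  · rw [constraintMap_inr, dij_apply_gen hd]
    split_ifs with h1 h2 h2
    · exact absurd (h1.symm.trans h2) hij
    · simp [coord_partial_eq_zero he hd (faceExp_of_ne (h1 ▸ hij.symm))]
    · simp [coord_partial_eq_zero he hd (faceExp_of_ne (h2 ▸ hij))]
    · simp

theorem constraintMap_complementVec (y : {b : Fin n → Fin p // b ≠ cornerExp n p} ⊕ Fin n) :
    constraintMap x e d (complementVec x d y) = Pi.single y 1 := by
  rcases y with b | i
  · have hb := freeIndex_spec b
    have hne : ((b.1 (freeIndex b) + 1 : ℕ) : F) ≠ 0 := cast_ne_zero_of_lt (by omega) hb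
    simp only [complementVec, Sum.elim_inl]
    set i := freeIndex b
    ext (c | m)
    · rw [constraintMap_inl, map_smul, divergence_smul_partial hd, partial_monomialAt hd]
      simp only [Finsupp.add_apply, expVec_apply, Finsupp.single_eq_same, add_tsub_cancel_right]
      rw [smul_smul, inv_mul_cancel₀ hne, one_smul, he]
      simp [Pi.single_apply, expVec_injective.eq_iff, Subtype.ext_iff, eq_comm]
    · rw [constraintMap_inr, Pi.single_eq_of_ne (by simp), Derivation.smul_apply,
        Derivation.smul_apply, hd]
      rcases eq_or_ne m i with hm | hm
      · rw [if_pos hm, hm, smul_eq_mul, mul_one, map_smul, Pi.smul_apply, he, if_neg,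
          smul_zero]
        intro h
        have := congr($h i)
        simp [faceExp_self] at this
      · simp [hm]
  · simp only [complementVec, Sum.elim_inr]
    ext (c | m)
    · rw [constraintMap_inl, divergence_smul_partial hd, partial_monomialAt hd]
      simp [faceExp_self]
    · rw [constraintMap_inr, Derivation.smul_apply, hd]
      rcases eq_or_ne m i with rfl | hm
      · simp [he]
      · simp [hm]

theorem monomialAt_smul_partial_mem (s : Fin n →₀ ℕ) (i : Fin n) :
    monomialAt x s • d i ∈
      spanDij p x d ⊔ Submodule.span F (Set.range (complementVec (p := p) x d)) := by
  set T := spanDij p x d ⊔ Submodule.span F (Set.range (complementVec (p := p) x d))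
  have hT : ∀ y, complementVec x d y ∈ T := fun y =>
    Submodule.mem_sup_right (Submodule.subset_span (Set.mem_range_self y))
  by_cases hs : ∀ k, s k < p
  swap
  · push Not at hs
    obtain ⟨k, hk⟩ := hs
    simp [monomialAt_eq_zero he hk]
  have hDij : ∀ j, j ≠ i → ((s j + 1 : ℕ) : F) • monomialAt x s • d i -
      (s i : F) • monomialAt x (s + Finsupp.single j 1 - Finsupp.single i 1) • d j ∈ T := by
    intro j hj
    have := Submodule.mem_sup_left (T := Submodule.span F (Set.range (complementVec (p := p) x d)))
      (dij_mem_spanDij he (d := d) i j (monomialAt x (s + Finsupp.single j 1)))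
    rw [dij, partial_monomialAt hd, partial_monomialAt hd] at this
    simpa [hj, smul_assoc] using this
  rcases Nat.eq_zero_or_pos (s i) with h0 | hpos
  · by_cases h : ∃ j, j ≠ i ∧ s j + 1 < p
    · obtain ⟨j, hj, hlt⟩ := h
      have := hDij j hj
      rw [h0, Nat.cast_zero, zero_smul, sub_zero] at this
      exact (Submodule.smul_mem_iff _ (cast_ne_zero_of_lt (by omega) hlt)).mp this
    · push Not at h
      have hface : s = expVec (faceExp n p i) := by
        ext j
        rw [expVec_apply]
        rcases eq_or_ne j i with rfl | hj
        · rw [h0, faceExp_self]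
        · rw [faceExp_of_ne hj]
          have := h j hj
          have := hs j
          omega
      rw [hface]
      exact hT (Sum.inr i)
  · obtain ⟨b, hb⟩ : ∃ b : Fin n → Fin p, expVec b = s - Finsupp.single i 1 :=
      exists_expVec fun k => (Nat.sub_le _ _).trans_lt (hs k)
    have hsb : s = expVec b + Finsupp.single i 1 := by
      rw [hb, tsub_add_cancel_of_le]
      simpa using! Nat.succ_le_of_lt hpos
    have hbi : (b i : ℕ) + 1 < p := by
      have := hs i
      rw [hsb] at this
      simpa using this
    have hbc : b ≠ cornerExp n p := by
      rintro rfl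
      simp only [cornerExp] at hbi
      omega
    have hmem := hT (Sum.inl ⟨b, hbc⟩)
    have hlt := freeIndex_spec ⟨b, hbc⟩
    simp only [complementVec, Sum.elim_inl] at hmem
    set j := freeIndex ⟨b, hbc⟩
    rw [Submodule.smul_mem_iff _ (inv_ne_zero (cast_ne_zero_of_lt (by omega) hlt))] at hmem
    rcases eq_or_ne j i with hj | hj
    · rwa [hj, ← hsb] at hmem
    · have hsj : s j = b j := by simp [hsb, hj]
      have h1 := hDij j hj
      rw [hsj, show s + Finsupp.single j 1 - Finsupp.single i 1 = expVec b + Finsupp.single j 1 by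
        rw [hsb, add_right_comm, add_tsub_cancel_right]] at h1
      have h2 := add_mem h1 (Submodule.smul_mem T (s i : F) hmem)
      rw [sub_add_cancel] at h2
      exact (Submodule.smul_mem_iff _ (cast_ne_zero_of_lt (by omega) hlt)).mp h2

theorem spanDij_sup_complement :
    spanDij p x d ⊔ Submodule.span F (Set.range (complementVec (p := p) x d)) = ⊤ := by
  rw [eq_top_iff]
  rintro D -
  rw [eq_sum_smul_partial he hd D]
  refine sum_mem fun i _ => ?_
  generalize D (x i) = f
  have hf : f ∈ Submodule.span F (Set.range (monomialAt x)) :=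
    span_monomialAt he ▸ Submodule.mem_top
  induction hf using Submodule.span_induction with
  | mem f hf =>
    obtain ⟨s, rfl⟩ := hf
    exact monomialAt_smul_partial_mem he hd s i
  | zero => simp
  | add f g _ _ hf hg =>
    rw [add_smul]
    exact add_mem hf hg
  | smul c f _ hf =>
    rw [smul_assoc]
    exact Submodule.smul_mem _ c hf

theorem constraintMap_sum (c : {b : Fin n → Fin p // b ≠ cornerExp n p} ⊕ Fin n → F) :
    constraintMap x e d (∑ y, c y • complementVec x d y) = c := by
  rw [map_sum]
  simp_rw [LinearMap.map_smul, constraintMap_complementVec he hd]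
  exact (pi_eq_sum_univ' c).symm

theorem ker_constraintMap : LinearMap.ker (constraintMap x e d) = spanDij p x d := by
  have hle : spanDij p x d ≤ LinearMap.ker (constraintMap x e d) := by
    refine Submodule.span_le.mpr ?_
    rintro _ ⟨i, j, -, a, rfl⟩
    exact constraintMap_dij he hd i j _
  refine le_antisymm (fun D hD => ?_) hle
  obtain ⟨v, hv, w, hw, rfl⟩ := Submodule.mem_sup.mp
    (spanDij_sup_complement he hd ▸ Submodule.mem_top (x := D))
  obtain ⟨c, rfl⟩ := (Submodule.mem_span_range_iff_exists_fun F).mp hw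
  rw [LinearMap.mem_ker, LinearMap.map_add, hle hv, constraintMap_sum he hd, zero_add] at hD
  simpa [hD] using hv

theorem finrank_spanDij (hn : 0 < n) :
    Module.finrank F (spanDij p x d) = (n - 1) * (p ^ n - 1) := by
  obtain ⟨hfin, hW⟩ := finrank_derivation he hd
  have hrange : LinearMap.range (constraintMap x e d) = ⊤ :=
    LinearMap.range_eq_top.mpr fun c => ⟨_, constraintMap_sum he hd c⟩
  have := LinearMap.finrank_range_add_finrank_ker (constraintMap x e d)
  rw [hrange, finrank_top, ker_constraintMap he hd, hW, Module.finrank_fintype_fun_eq_card] at this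
  simp only [Fintype.card_sum, Fintype.card_subtype_compl, Fintype.card_fin, Fintype.card_pi,
    Finset.prod_const, Finset.card_univ, Fintype.card_subtype_eq, ne_eq] at this
  obtain ⟨m, rfl⟩ := Nat.exists_eq_add_of_lt hn
  obtain ⟨q, hq⟩ := Nat.exists_eq_add_of_lt (pow_pos (NeZero.pos p) (0 + m + 1))
  rw [hq] at this ⊢
  simp only [zero_add, add_tsub_cancel_right] at this ⊢
  linarith

end Prime

end TruncatedCoordinates

section TruncPoly

variable {F : Type*} [Field F] {p n : ℕ}

theorem mem_truncIdeal_iff {f : MvPolynomial (Fin n) F} :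
    f ∈ truncIdeal F p n ↔ ∀ b : Fin n → Fin p, f.coeff (expVec b) = 0 := by
  have hspan : truncIdeal F p n = Ideal.span ((fun s => MvPolynomial.monomial s (1 : F)) ''
      Set.range fun i : Fin n => Finsupp.single i p) := by
    rw [truncIdeal, ← Set.range_comp]
    congr! 3 with i
    exact MvPolynomial.X_pow_eq_monomial
  rw [hspan, MvPolynomial.mem_ideal_span_monomial_image]
  constructor
  · intro h b
    by_contra hb
    obtain ⟨_, ⟨i, rfl⟩, hi⟩ := h _ (MvPolynomial.mem_support_iff.mpr hb)
    have := hi i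
    simp at this
    have := (b i).isLt
    omega
  · intro h s hs
    by_contra! hlt
    obtain ⟨b, rfl⟩ : ∃ b : Fin n → Fin p, expVec b = s := by
      refine exists_expVec fun i => ?_
      have := hlt _ ⟨i, rfl⟩
      simpa using this
    exact MvPolynomial.mem_support_iff.mp hs (h b)

theorem monomialAt_xcl (s : Fin n →₀ ℕ) :
    monomialAt (xcl F p n) s = Ideal.Quotient.mk _ (MvPolynomial.monomial s 1) := by
  simp [monomialAt, xcl, ← map_pow, ← map_prod, MvPolynomial.monomial_eq, Finsupp.prod_fintype]

theorem exists_coordEquiv (F : Type*) [Field F] (p n : ℕ) :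
    ∃ e : TruncPoly F p n ≃ₗ[F] ((Fin n → Fin p) → F),
      ∀ s b, e (monomialAt (xcl F p n) s) b = if s = expVec b then 1 else 0 := by
  let c : MvPolynomial (Fin n) F →ₗ[F] ((Fin n → Fin p) → F) :=
    LinearMap.pi fun b => MvPolynomial.lcoeff F (expVec b)
  have hker : LinearMap.ker c = (truncIdeal F p n).restrictScalars F := by
    ext f
    rw [LinearMap.mem_ker, Submodule.restrictScalars_mem, mem_truncIdeal_iff, funext_iff]
    rfl
  have hsurj : Function.Surjective c := by
    intro v
    refine ⟨∑ b, MvPolynomial.monomial (expVec b) (v b), ?_⟩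
    ext b
    simp [c, MvPolynomial.coeff_monomial, expVec_injective.eq_iff]
  refine ⟨(Submodule.Quotient.restrictScalarsEquiv F _).symm ≪≫ₗ
    Submodule.quotEquivOfEq _ _ hker.symm ≪≫ₗ c.quotKerEquivOfSurjective hsurj, fun s b => ?_⟩
  rw [monomialAt_xcl]
  change MvPolynomial.coeff (expVec b) (MvPolynomial.monomial s (1 : F)) = _
  rw [MvPolynomial.coeff_monomial]

end TruncPoly

/-- `S(n)` has dimension `(n-1)(pⁿ-1)` and is spanned by the `D_{ij}(x^a)`,
`1 ≤ i < j ≤ n`. -/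
theorem special_dim_and_span
    (F : Type*) [Field F] (p n : ℕ) (hp : 0 < p) [CharP F p] (hn : 3 ≤ n)
    (Dj : Fin n → WittJacobson F p n)
    (hDj : ∀ j i, Dj j (xcl F p n i) = if i = j then 1 else 0) :
    Module.finrank F ↥(Special F p n) = (n - 1) * (p ^ n - 1) ∧
    Special F p n = Submodule.span F
      {z | ∃ i j : Fin n, i < j ∧ ∃ a : Fin n → Fin p,
        z = Dij F p n Dj i j (∏ k, xcl F p n k ^ (a k : ℕ))} := by
  have : NeZero p := ⟨hp.ne'⟩
  obtain ⟨e, he⟩ := exists_coordEquiv F p n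
  have hspan : Special F p n = spanDij p (xcl F p n) Dj := lieSpan_eq_spanDij he hDj
  refine ⟨?_, hspan⟩
  rw [hspan]
  exact finrank_spanDij he hDj (by omega)

end
end

section
/- Let F be a field of characteristic p > 3. Then the Witt algebra W(1) = Der_F(F[X]/(X^p)) is a simple Lie algebra and its Killing form is degenerate. -/
/-!
STATEMENT 10: for a field `F` of characteristic `p > 3`, the Witt algebra
`W(1) = Der_F (F[X]/(X^p))` is a simple Lie algebra and its Killing form is degenerate.
-/

set_option maxHeartbeats 1000000
set_option synthInstance.maxHeartbeats 400000

noncomputable section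

/-- The truncated polynomial ring `F[X]/(X^p)`. -/
abbrev TruncPoly1 (F : Type*) [Field F] (p : ℕ) :=
  Polynomial F ⧸ Ideal.span {(Polynomial.X : Polynomial F) ^ p}

/-- The Witt algebra `W(1) = Der_F (F[X]/(X^p))`. -/
abbrev Witt1 (F : Type*) [Field F] (p : ℕ) :=
  Derivation F (TruncPoly1 F p) (TruncPoly1 F p)

namespace Witt1

open Polynomial

section Derivation

variable {R A : Type*} [CommRing R] [CommRing A] [Algebra R A]

theorem smul_lie_smul (D : Derivation R A A) (a b : A) :
    ⁅a • D, b • D⁆ = (a * D b - b * D a) • D := by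
  ext c
  simp only [Derivation.commutator_apply, Derivation.smul_apply, smul_eq_mul, Derivation.leibniz]
  ring

theorem apply_pow_succ (D : Derivation R A A) {x : A} (hx : D x = 1) (n : ℕ) :
    D (x ^ (n + 1)) = (n + 1) * x ^ n := by
  simp [Derivation.leibniz_pow, hx]

theorem lie_lie_eq_zero_of_eq_pow_mul (D : Derivation R A A) {x : A} (hx : D x = 1) {m : ℕ}
    (hm : x ^ (m + 5) = 0) (g b : A) :
    ⁅x ^ (m + 4) • D, ⁅b • D, (x ^ (m + 3) * g) • D⁆⁆ = 0 := by
  have h : x ^ (2 * m + 5) = 0 := pow_eq_zero_of_le (by omega) hm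
  obtain ⟨h₁, hh₁⟩ : ∃ h₁, b * D (x ^ (m + 3) * g) - x ^ (m + 3) * g * D b = x ^ (m + 2) * h₁ := by
    refine ⟨b * (x * D g + (m + 3) * g) - x * g * D b, ?_⟩
    rw [D.leibniz, apply_pow_succ D hx (m + 2)]
    simp only [smul_eq_mul]
    push_cast
    ring
  rw [smul_lie_smul, smul_lie_smul, hh₁, D.leibniz, apply_pow_succ D hx (m + 1),
    apply_pow_succ D hx (m + 3)]
  convert zero_smul A D
  simp only [smul_eq_mul]
  push_cast
  linear_combination (x * D h₁ + (m + 2) * h₁ - (m + 4) * h₁) * h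

theorem exists_lie_lie_eq_pow_mul (D : Derivation R A A) {x : A} (hx : D x = 1) (m : ℕ) (a b : A) :
    ∃ g, ⁅x ^ (m + 4) • D, ⁅b • D, a • D⁆⁆ = (x ^ (m + 3) * g) • D := by
  rw [smul_lie_smul, smul_lie_smul, apply_pow_succ D hx (m + 3)]
  refine ⟨x * D (b * D a - a * D b) - (m + 4) * (b * D a - a * D b), ?_⟩
  congr 1
  push_cast
  ring

end Derivation

variable (F : Type*) [Field F] (p : ℕ)

/-- The class of `X` in `F[X]/(X^p)`. -/
def gen : TruncPoly1 F p := Ideal.Quotient.mk _ X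

theorem gen_pow (n : ℕ) (hn : p ≤ n) : gen F p ^ n = 0 := by
  rw [gen, ← map_pow, Ideal.Quotient.eq_zero_iff_dvd]
  exact pow_dvd_pow X hn

variable {F} in
theorem aeval_gen (f : F[X]) : aeval (gen F p) f = Ideal.Quotient.mk _ f :=
  AdjoinRoot.aeval_eq (f := (X : F[X]) ^ p) f

variable {F p} in
theorem exists_aeval_gen (a : TruncPoly1 F p) : ∃ f : F[X], aeval (gen F p) f = a := by
  obtain ⟨f, rfl⟩ := Ideal.Quotient.mk_surjective a
  exact ⟨f, aeval_gen p f⟩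

variable {F p} in
theorem aeval_gen_eq_zero_iff (f : F[X]) : aeval (gen F p) f = 0 ↔ X ^ p ∣ f := by
  rw [aeval_gen, Ideal.Quotient.eq_zero_iff_dvd]

theorem exists_derivation [CharP F p] : ∃ D : Witt1 F p, D (gen F p) = 1 := by
  have hs : Function.Surjective (aeval (R := F) (gen F p)) := exists_aeval_gen
  have hd (f : F[X]) (hf : aeval (gen F p) f = 0) :
      aeval (gen F p) (derivative' (R := F) f) = 0 := by
    rw [aeval_gen_eq_zero_iff] at hf
    obtain ⟨g, rfl⟩ := hf
    rw [aeval_gen_eq_zero_iff]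
    simp
  refine ⟨Derivation.liftOfSurjective hs hd, ?_⟩
  have := Derivation.liftOfSurjective_apply hs hd X
  simpa using this

variable {F p} {D : Witt1 F p} (hD : D (gen F p) = 1)

include hD

theorem eq_smul (E : Witt1 F p) : E = E (gen F p) • D := by
  ext a
  obtain ⟨f, rfl⟩ := exists_aeval_gen a
  simp [Derivation.map_aeval, hD, mul_comm]

theorem apply_aeval (f : F[X]) : D (aeval (gen F p) f) = aeval (gen F p) (derivative f) := by
  simp [Derivation.map_aeval, hD]

theorem lie_aeval_smul (f : F[X]) :
    ⁅D, aeval (gen F p) f • D⁆ = aeval (gen F p) (derivative f) • D := by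
  have := smul_lie_smul D 1 (aeval (gen F p) f)
  simpa [apply_aeval hD] using this

theorem derivation_mem_of_aeval_smul_mem [CharP F p] (I : LieIdeal F (Witt1 F p)) (n : ℕ)
    (hn : n < p) (f : F[X]) (hf : f ≠ 0) (hfn : f.natDegree = n)
    (h : aeval (gen F p) f • D ∈ I) : D ∈ I := by
  induction n generalizing f with
  | zero =>
    rw [eq_C_of_natDegree_eq_zero hfn, aeval_C, algebraMap_smul] at h
    refine (I.toSubmodule.smul_mem_iff fun h0 ↦ hf ?_).1 h
    rw [eq_C_of_natDegree_eq_zero hfn, h0, C_0]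
  | succ n ih =>
    have hc : (derivative f).coeff n ≠ 0 := by
      rw [coeff_derivative, ← hfn]
      refine mul_ne_zero (by rw [coeff_natDegree]; exact leadingCoeff_ne_zero.2 hf) ?_
      have := (CharP.cast_eq_zero_iff F p (n + 1)).not.2 (Nat.not_dvd_of_pos_of_lt n.succ_pos hn)
      exact_mod_cast this
    refine ih (by omega) (derivative f) (fun h0 ↦ hc (by simp [h0])) ?_ ?_
    · have := natDegree_derivative_le f
      have := le_natDegree_of_ne_zero hc
      omega
    · rw [← lie_aeval_smul hD]
      exact lie_mem_right F _ I _ _ h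

theorem derivation_mem_of_ne_bot [CharP F p] (hp : 0 < p) (I : LieIdeal F (Witt1 F p))
    (hI : I ≠ ⊥) : D ∈ I := by
  obtain ⟨E, hE, hE0⟩ := Submodule.exists_mem_ne_zero_of_ne_bot (p := I.toSubmodule)
    (by simpa using hI)
  obtain ⟨f, hf⟩ := exists_aeval_gen (E (gen F p))
  have hm : (X ^ p : F[X]).Monic := monic_X_pow p
  have hr : aeval (gen F p) (f %ₘ X ^ p) = E (gen F p) := by
    rw [← hf, ← sub_eq_zero, ← map_sub, aeval_gen_eq_zero_iff, ← dvd_neg, neg_sub]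
    exact ⟨f /ₘ X ^ p, by linear_combination -modByMonic_add_div f (X ^ p : F[X])⟩
  refine derivation_mem_of_aeval_smul_mem hD I _ ?_ (f %ₘ X ^ p) ?_ rfl ?_
  · have := natDegree_modByMonic_lt f hm (fun h ↦ by
      have := congrArg natDegree h
      simp at this
      omega)
    simpa using this
  · intro h0
    rw [h0, map_zero] at hr
    exact hE0 (by rw [eq_smul hD E, ← hr]; exact zero_smul (TruncPoly1 F p) D)
  · rwa [hr, ← eq_smul hD]

theorem eq_top_of_derivation_mem [CharP F p] (hp : 3 < p) (I : LieIdeal F (Witt1 F p))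
    (hI : D ∈ I) : I = ⊤ := by
  have cast_ne {n : ℕ} (h0 : 0 < n) (hn : n < p) : (n : F) ≠ 0 :=
    (CharP.cast_eq_zero_iff F p n).not.2 (Nat.not_dvd_of_pos_of_lt h0 hn)
  have hsmall (n : ℕ) (hn : n + 1 < p) : gen F p ^ n • D ∈ I := by
    have h := lie_mem_left F _ I D (aeval (gen F p) (X ^ (n + 1) : F[X]) • D) hI
    rw [lie_aeval_smul hD, derivative_X_pow, map_mul, aeval_C, Nat.add_sub_cancel, map_pow, aeval_X,
      ← Algebra.smul_def, smul_assoc] at h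
    exact (I.toSubmodule.smul_mem_iff (cast_ne n.succ_pos hn)).1 h
  have hpow (n : ℕ) : gen F p ^ n • D ∈ I := by
    rcases lt_trichotomy (n + 1) p with hn | hn | hn
    · exact hsmall n hn
    · obtain ⟨m, rfl⟩ : ∃ m, n = m + 3 := ⟨n - 3, by omega⟩
      have hprime : p.Prime := CharP.char_is_prime_or_zero F p |>.resolve_right (by omega)
      have hm : m ≠ 0 := by
        rintro rfl
        rw [← hn] at hprime
        revert hprime
        decide
      have h := lie_mem_right F _ I (gen F p ^ (1 + 1) • D) _ (hsmall (m + 1 + 1) (by omega))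
      rw [smul_lie_smul, apply_pow_succ D hD, apply_pow_succ D hD] at h
      have heq : gen F p ^ (1 + 1) * (((m + 1 : ℕ) + 1) * gen F p ^ (m + 1)) -
          gen F p ^ (m + 1 + 1) * (((1 : ℕ) + 1) * gen F p ^ 1) = (m : F) • gen F p ^ (m + 3) := by
        rw [Nat.cast_smul_eq_nsmul, nsmul_eq_mul]
        push_cast
        ring
      rw [heq, smul_assoc] at h
      exact (I.toSubmodule.smul_mem_iff (cast_ne (by omega) (by omega))).1 h
    · rw [gen_pow F p n (by omega)]
      convert zero_mem I
      exact zero_smul (TruncPoly1 F p) D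
  refine eq_top_iff.2 fun E _ ↦ ?_
  obtain ⟨f, hf⟩ := exists_aeval_gen (E (gen F p))
  rw [eq_smul hD E, ← hf, aeval_eq_sum_range, Finset.sum_smul]
  refine sum_mem fun i _ ↦ ?_
  rw [smul_assoc]
  exact I.smul_mem _ (hpow i)

theorem killingForm_pow_smul_eq_zero {m : ℕ} (hm : p = m + 5) (E : Witt1 F p) :
    killingForm F (Witt1 F p) (gen F p ^ (m + 4) • D) E = 0 := by
  rw [killingForm_apply_apply]
  refine (LinearMap.isNilpotent_trace_of_isNilpotent ⟨2, ?_⟩).eq_zero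
  ext1 G
  rw [pow_two, eq_smul hD E, eq_smul hD G]
  obtain ⟨g, hg⟩ := exists_lie_lie_eq_pow_mul D hD m (G (gen F p)) (E (gen F p))
  simp only [Module.End.mul_apply, LinearMap.comp_apply, LieAlgebra.ad_apply, hg]
  exact lie_lie_eq_zero_of_eq_pow_mul D hD (gen_pow F p _ hm.le) g _

theorem pow_smul_ne_zero {n : ℕ} (hn : n < p) : gen F p ^ n • D ≠ 0 := by
  intro h
  have h' := DFunLike.congr_fun h (gen F p)
  rw [Derivation.smul_apply, hD, smul_eq_mul, mul_one, Derivation.zero_apply,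
    ← aeval_X_pow (R := F), aeval_gen_eq_zero_iff, pow_dvd_pow_iff X_ne_zero not_isUnit_X] at h'
  omega

end Witt1

/-- `W(1)` is simple with degenerate Killing form. -/
theorem witt1_simple_killing_degenerate
    (F : Type*) [Field F] (p : ℕ) [CharP F p] (hp : 3 < p) :
    LieAlgebra.IsSimple F (Witt1 F p) ∧
    ¬ (killingForm F (Witt1 F p)).Nondegenerate := by
  obtain ⟨D, hD⟩ := Witt1.exists_derivation F p
  refine ⟨⟨fun I ↦ or_iff_not_imp_left.2 fun hI ↦ ?_, fun hab ↦ ?_⟩, fun hnd ↦ ?_⟩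
  · exact Witt1.eq_top_of_derivation_mem hD hp I
      (Witt1.derivation_mem_of_ne_bot hD (by omega) I hI)
  · have h := Witt1.lie_aeval_smul hD Polynomial.X
    rw [hab.trivial, Polynomial.derivative_X, map_one, ← pow_zero (Witt1.gen F p)] at h
    exact Witt1.pow_smul_ne_zero hD (by omega) h.symm
  · have hprime : p.Prime := CharP.char_is_prime_or_zero F p |>.resolve_right (by omega)
    have hp4 : p ≠ 4 := by
      rintro rfl
      revert hprime
      decide
    obtain ⟨m, hm⟩ : ∃ m, p = m + 5 := ⟨p - 5, by omega⟩
    exact Witt1.pow_smul_ne_zero hD (by omega)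
      (hnd.1 _ (Witt1.killingForm_pow_smul_eq_zero hD hm))

end
end

section
/- Let L be a Lie algebra over a field F of characteristic p > 0 and let D : L → L be a derivation of L. Then the 2-cochain Sq(D) defined by Sq(D)(x,y) = Σ_{i=1}^{p−1} [D^i(x), D^{p−i}(y)] / (i!·(p−i)!) is a 2-cocycle of L with values in the adjoint representation, i.e. its Chevalley–Eilenberg coboundary vanishes. -/
/-!
STATEMENT 11: for a Lie algebra `L` over a field of characteristic `p > 0` and a
derivation `D : L → L`, the squaring
`Sq(D)(x,y) = ∑_{i=1}^{p-1} ⁅Dⁱx, D^{p-i}y⁆ / (i!(p-i)!)`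
is a `2`-cocycle of `L` with values in the adjoint representation: it is alternating,
bilinear, and its Chevalley–Eilenberg coboundary vanishes.
-/

set_option maxHeartbeats 1000000

/-- `c : L × L → L` is a `2`-cocycle for the adjoint representation: an alternating
bilinear map satisfying the Chevalley–Eilenberg cocycle identity. -/
def IsLieCocycle2 (F : Type*) {L : Type*} [Field F] [LieRing L] [LieAlgebra F L]
    (c : L → L → L) : Prop :=
  (∀ (t : F) (x x' y : L), c (t • x + x') y = t • c x y + c x' y) ∧
  (∀ (t : F) (x y y' : L), c x (t • y + y') = t • c x y + c x y') ∧
  (∀ x : L, c x x = 0) ∧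
  (∀ x y z : L,
    ⁅x, c y z⁆ + ⁅y, c z x⁆ + ⁅z, c x y⁆ +
      c x ⁅y, z⁆ + c y ⁅z, x⁆ + c z ⁅x, y⁆ = 0)

/-- The squaring `Sq(D)` of a map `D : L → L`:
`Sq(D)(x,y) = ∑_{i=1}^{p-1} (i!(p-i)!)⁻¹ • ⁅Dⁱ x, D^{p-i} y⁆`. -/
noncomputable def sqCochain (F : Type*) {L : Type*} [Field F] [LieRing L]
    [LieAlgebra F L] (p : ℕ) (D : L → L) : L → L → L :=
  fun x y => ∑ i ∈ Finset.Icc 1 (p - 1),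
    (((Nat.factorial i * Nat.factorial (p - i) : ℕ) : F))⁻¹ • ⁅D^[i] x, D^[p - i] y⁆

open Finset in
theorem sum_range_ite_add_eq {M : Type*} [AddCommMonoid M] (p a n : ℕ) (f : ℕ → M) :
    (∑ b ∈ range p, if a + b = n then f b else 0) =
      if a ≤ n ∧ n - a < p then f (n - a) else 0 := by
  by_cases h : a ≤ n
  · have hb : ∀ b, a + b = n ↔ n - a = b := fun b => by omega
    simp [hb, h]
  · rw [if_neg (by tauto)]
    exact sum_eq_zero fun b _ => if_neg (by omega)

/-- The divided power `Dⁿ / n!`. -/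
noncomputable def dividedIterate (F : Type*) {L : Type*} [Field F] [LieRing L]
    [LieAlgebra F L] (D : L → L) (n : ℕ) (x : L) : L :=
  ((n.factorial : F))⁻¹ • D^[n] x

section

variable {F L : Type*} [Field F] [LieRing L] [LieAlgebra F L]

theorem dividedIterate_zero (D : L → L) (x : L) : dividedIterate F D 0 x = x := by
  simp [dividedIterate]

theorem lie_dividedIterate (D : L → L) (a b : ℕ) (x y : L) :
    ⁅dividedIterate F D a x, dividedIterate F D b y⁆ =
      ((a.factorial * b.factorial : ℕ) : F)⁻¹ • ⁅D^[a] x, D^[b] y⁆ := by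
  simp [dividedIterate, smul_smul, mul_comm]

theorem dividedIterate_lie (D : LieDerivation F L L) (n : ℕ) (hn : (n.factorial : F) ≠ 0)
    (x y : L) :
    dividedIterate F D n ⁅x, y⁆ =
      ∑ ij ∈ Finset.HasAntidiagonal.antidiagonal n,
        ⁅dividedIterate F D ij.1 x, dividedIterate F D ij.2 y⁆ := by
  rw [dividedIterate, LieDerivation.iterate_apply_lie, Finset.smul_sum]
  refine Finset.sum_congr rfl fun ij hij => ?_
  rw [Finset.HasAntidiagonal.mem_antidiagonal] at hij
  rw [lie_dividedIterate, ← Nat.cast_smul_eq_nsmul F, smul_smul]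
  congr 1
  have h := Nat.add_choose_mul_factorial_mul_factorial ij.1 ij.2
  rw [hij, ← Nat.choose_symm_of_eq_add hij.symm] at h
  have h' : ((n.choose ij.1 : ℕ) : F) * ((ij.1.factorial * ij.2.factorial : ℕ) : F) =
      n.factorial := by rw [← h]; push_cast; ring
  have h0 : ((ij.1.factorial * ij.2.factorial : ℕ) : F) ≠ 0 := fun h1 => hn (by
    rw [← h', h1, mul_zero])
  rw [← h'] at hn ⊢
  have := left_ne_zero_of_mul hn
  field_simp

open Finset in
theorem dividedIterate_lie_eq_sum_range (D : LieDerivation F L L) (p n : ℕ) (hnp : n < p)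
    (hn : (n.factorial : F) ≠ 0) (x y : L) :
    dividedIterate F D n ⁅x, y⁆ = ∑ a ∈ range p, ∑ b ∈ range p,
      if a + b = n then ⁅dividedIterate F D a x, dividedIterate F D b y⁆ else 0 := by
  simp_rw [dividedIterate_lie D n hn, sum_range_ite_add_eq]
  rw [Nat.sum_antidiagonal_eq_sum_range_succ_mk]
  refine sum_subset_zero_on_sdiff (range_subset_range.2 hnp) (fun a ha => ?_) fun a ha => ?_
  · simp only [mem_sdiff, mem_range] at ha
    exact if_neg (by omega)
  · rw [mem_range] at ha
    rw [if_pos (by omega)]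

open Finset in
theorem sqCochain_eq_sum_Icc (p : ℕ) (D : L → L) (x y : L) :
    sqCochain F p D x y = ∑ i ∈ Icc 1 (p - 1),
      ⁅dividedIterate F D i x, dividedIterate F D (p - i) y⁆ :=
  sum_congr rfl fun _ _ => (lie_dividedIterate ..).symm

open Finset in
theorem sqCochain_eq_sum_range (p : ℕ) (D : L → L) (x y : L) :
    sqCochain F p D x y = ∑ a ∈ range p, ∑ b ∈ range p,
      if a + b = p then ⁅dividedIterate F D a x, dividedIterate F D b y⁆ else 0 := by
  simp_rw [sqCochain_eq_sum_Icc, sum_range_ite_add_eq]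
  refine sum_subset_zero_on_sdiff (fun a ha => ?_) (fun a ha => ?_) fun a ha => ?_
  · rw [mem_Icc] at ha
    rw [mem_range]
    omega
  · simp only [mem_sdiff, mem_range, mem_Icc] at ha
    exact if_neg (by omega)
  · rw [mem_Icc] at ha
    rw [if_pos (by omega)]

open Finset in
/-- The part of the coboundary of `Sq(D)` with outer bracket entry `x`, as a sum over triples of
exponents smaller than `p` with sum `p`. -/
theorem lie_sqCochain_add_sqCochain_lie (p : ℕ) (D : LieDerivation F L L) (hp : 0 < p)
    (hfac : ∀ n < p, (n.factorial : F) ≠ 0) (x y z : L) :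
    ⁅x, sqCochain F p D y z⁆ + sqCochain F p D x ⁅y, z⁆ =
      ∑ i ∈ range p, ∑ a ∈ range p, ∑ b ∈ range p, if i + a + b = p then
        ⁅dividedIterate F D i x, ⁅dividedIterate F D a y, dividedIterate F D b z⁆⁆ else 0 := by
  have hsum : ∀ i n, (∀ a b, i + a + b = p ↔ a + b = n) →
      (∑ a ∈ range p, ∑ b ∈ range p, if i + a + b = p then
        ⁅dividedIterate F D i x, ⁅dividedIterate F D a y, dividedIterate F D b z⁆⁆ else 0) =
      ⁅dividedIterate F D i x, ∑ a ∈ range p, ∑ b ∈ range p, if a + b = n then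
        ⁅dividedIterate F D a y, dividedIterate F D b z⁆ else 0⁆ := by
    intro i n h
    simp_rw [lie_sum, h]
    refine sum_congr rfl fun a _ => sum_congr rfl fun b _ => ?_
    split_ifs <;> simp
  have hrange : range p = insert 0 (Icc 1 (p - 1)) := by
    ext i
    simp only [mem_range, mem_insert, mem_Icc]
    omega
  rw [← sum_subset (s₁ := insert 0 (Icc 1 (p - 1))) hrange.ge fun i hi hi' =>
    absurd (hrange ▸ hi) hi', sum_insert (by simp)]
  congr 1
  · rw [hsum 0 p fun a b => by omega, dividedIterate_zero, sqCochain_eq_sum_range]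
  · rw [sqCochain_eq_sum_Icc]
    refine sum_congr rfl fun i hi => ?_
    rw [mem_Icc] at hi
    rw [hsum i (p - i) fun a b => by omega,
      ← dividedIterate_lie_eq_sum_range D p (p - i) (by omega) (hfac _ (by omega))]

open Finset in
theorem sqCochain_coboundary (p : ℕ) (D : LieDerivation F L L) (hp : 0 < p)
    (hfac : ∀ n < p, (n.factorial : F) ≠ 0) (x y z : L) :
    ⁅x, sqCochain F p D y z⁆ + ⁅y, sqCochain F p D z x⁆ + ⁅z, sqCochain F p D x y⁆ +
      sqCochain F p D x ⁅y, z⁆ + sqCochain F p D y ⁅z, x⁆ + sqCochain F p D z ⁅x, y⁆ = 0 := by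
  have hx := lie_sqCochain_add_sqCochain_lie p D hp hfac x y z
  have hy := lie_sqCochain_add_sqCochain_lie p D hp hfac y z x
  have hz := lie_sqCochain_add_sqCochain_lie p D hp hfac z x y
  rw [sum_comm_cycle] at hy
  rw [← sum_comm_cycle] at hz
  calc
    _ = (⁅x, sqCochain F p D y z⁆ + sqCochain F p D x ⁅y, z⁆) +
        (⁅y, sqCochain F p D z x⁆ + sqCochain F p D y ⁅z, x⁆) +
        (⁅z, sqCochain F p D x y⁆ + sqCochain F p D z ⁅x, y⁆) := by abel
    _ = 0 := by
      rw [hx, hy, hz]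
      simp_rw [← sum_add_distrib]
      refine sum_eq_zero fun i _ => sum_eq_zero fun a _ => sum_eq_zero fun b _ => ?_
      by_cases h : i + a + b = p
      · rw [if_pos h, if_pos (by omega), if_pos (by omega)]
        exact lie_jacobi _ _ _
      · rw [if_neg h, if_neg (by omega), if_neg (by omega)]
        simp

open Finset in
theorem sqCochain_swap (p : ℕ) (D : L → L) (x y : L) :
    sqCochain F p D y x = -sqCochain F p D x y := by
  simp_rw [sqCochain_eq_sum_range, ← sum_neg_distrib]
  rw [sum_comm]
  refine sum_congr rfl fun a _ => sum_congr rfl fun b _ => ?_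
  simp_rw [add_comm b a]
  split_ifs <;> simp

theorem sqCochain_self (p : ℕ) [CharP F p] (hp : p.Prime) (D : L → L) (x : L) :
    sqCochain F p D x x = 0 := by
  by_cases h2 : p = 2
  · subst h2
    simp [sqCochain]
  · have h : (2 : F) • sqCochain F p D x x = 0 := by
      rw [two_smul]
      nth_rewrite 1 [sqCochain_swap]
      exact neg_add_cancel _
    refine (smul_eq_zero.1 h).resolve_left fun h0 => h2 ?_
    exact (Nat.prime_dvd_prime_iff_eq hp Nat.prime_two).1
      ((CharP.cast_eq_zero_iff F p 2).1 (by exact_mod_cast h0))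

end

/-- `Sq(D)` is a `2`-cocycle for any derivation `D` of `L`. -/
theorem sq_isCocycle
    (F L : Type*) [Field F] [LieRing L] [LieAlgebra F L]
    (p : ℕ) (hp : 0 < p) [CharP F p]
    (D : L →ₗ[F] L) (hD : ∀ x y : L, D ⁅x, y⁆ = ⁅D x, y⁆ + ⁅x, D y⁆) :
    IsLieCocycle2 F (sqCochain F p (fun z => D z)) := by
  have hprime : p.Prime := (CharP.char_is_prime_or_zero F p).resolve_right hp.ne'
  have hfac : ∀ n < p, (n.factorial : F) ≠ 0 := fun n hn h =>
    (hprime.dvd_factorial.1 ((CharP.cast_eq_zero_iff F p _).1 h)).not_gt hn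
  let D' : LieDerivation F L L :=
    { D with
      leibniz' := fun x y => by
        change D ⁅x, y⁆ = ⁅x, D y⁆ - ⁅y, D x⁆
        rw [hD, ← lie_skew y (D x)]
        abel }
  have hit (n : ℕ) (t : F) (x y : L) :
      (fun z => D z)^[n] (t • x + y) = t • (fun z => D z)^[n] x + (fun z => D z)^[n] y := by
    change D^[n] _ = t • D^[n] x + D^[n] y
    simp only [← Module.End.pow_apply, map_add, map_smul]
  refine ⟨fun t x x' y => ?_, fun t x y y' => ?_, sqCochain_self p hprime _,
    sqCochain_coboundary p D' hp hfac⟩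
  · simp only [sqCochain, Finset.smul_sum, ← Finset.sum_add_distrib, hit, add_lie, smul_lie,
      smul_add]
    exact Finset.sum_congr rfl fun i _ => by rw [smul_comm]
  · simp only [sqCochain, Finset.smul_sum, ← Finset.sum_add_distrib, hit, lie_add, lie_smul,
      smul_add]
    exact Finset.sum_congr rfl fun i _ => by rw [smul_comm]
end

section
/- Let F be a field of characteristic p > 0 and let (L, [p]) be a finite-dimensional restricted Lie algebra over F that is simple as a restricted Lie algebra (no nonzero proper ideal closed under the p-map). Then the derived subalgebra [L, L] is a simple Lie algebra, and moreover the p-closure of [L, L] inside L equals L, so that L is (isomorphic to) the restricted subalgebra of Der_F([L,L]) generated by ad([L,L]). -/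
/-!
STATEMENT 18: let `(L, [p])` be a finite-dimensional restricted Lie algebra over a field
of characteristic `p > 0` which is simple as a restricted Lie algebra (non-abelian, with
no nonzero proper ideal closed under the `p`-map).  Then `[L, L]` is a simple Lie
algebra, the `p`-closure of `[L, L]` in `L` is all of `L` (every restricted subalgebra
of `L` containing `[L, L]` is `L`), and `L` is isomorphic to the restricted subalgebra
of `Der_F([L,L])` generated by `ad([L,L])` (the smallest Lie subalgebra of
`Der_F([L,L])` containing the image of `ad` and closed under `D ↦ D^p`), compatibly
with brackets and `p`-structures.
-/

set_option maxHeartbeats 1000000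

/-- The universal Jacobson polynomial `s_i(x,y)`. -/
noncomputable def jacobsonS (F : Type*) {L : Type*} [Field F] [LieRing L] [LieAlgebra F L]
    (p i : ℕ) (x y : L) : L :=
  (-(i : F)⁻¹) •
    ∑ u ∈ Finset.univ.filter
        (fun u : Fin (p - 1) → Bool =>
          (Finset.univ.filter fun k => u k = false).card = i),
      (List.ofFn fun k => LieAlgebra.ad F L (if u k then y else x)).prod y

/-- `pm : L → L` is a `p`-map on the Lie algebra `L`. -/
def IsPMap (F : Type*) {L : Type*} [Field F] [LieRing L] [LieAlgebra F L]
    (p : ℕ) (pm : L → L) : Prop :=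
  (∀ x : L, LieAlgebra.ad F L (pm x) = LieAlgebra.ad F L x ^ p) ∧
  (∀ (a : F) (x : L), pm (a • x) = a ^ p • pm x) ∧
  (∀ x y : L, pm (x + y) = pm x + pm y + ∑ i ∈ Finset.Icc 1 (p - 1), jacobsonS F p i x y)

section RestrictedSimple

variable {F L : Type*} [Field F] [LieRing L] [LieAlgebra F L]

/-- Positive powers of `ad x` map `L` into any ideal `I` with `⁅x, L⁆ ⊆ I`. -/
lemma LieIdeal.ad_pow_mem (I : LieIdeal F L) {x : L} (hx : ∀ y : L, ⁅x, y⁆ ∈ I)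
    {n : ℕ} (hn : n ≠ 0) (y : L) : (LieAlgebra.ad F L x ^ n) y ∈ I := by
  obtain ⟨k, rfl⟩ := Nat.exists_eq_succ_of_ne_zero hn
  rw [Nat.succ_eq_add_one, pow_succ', Module.End.mul_apply]
  exact hx _

lemma Submodule.ad_pow_mem (N : Submodule F L) {x : L} (hx : ∀ y ∈ N, ⁅x, y⁆ ∈ N)
    (n : ℕ) : ∀ y ∈ N, (LieAlgebra.ad F L x ^ n) y ∈ N := by
  induction n with
  | zero => intro y hy; simpa using hy
  | succ k ih =>
    intro y hy
    rw [pow_succ', Module.End.mul_apply]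
    exact hx _ (ih y hy)

lemma lie_mem_derivedSeries_one (x y : L) : ⁅x, y⁆ ∈ LieAlgebra.derivedSeries F L 1 :=
  LieSubmodule.lie_mem_lie (LieSubmodule.mem_top x) (LieSubmodule.mem_top y)

lemma derivedSeries_one_le {I : LieIdeal F L} (h : ∀ x y : L, ⁅x, y⁆ ∈ I) :
    LieAlgebra.derivedSeries F L 1 ≤ I :=
  (LieSubmodule.lie_le_iff _ _ _).2 fun x _ y _ => h x y

lemma derivedSeries_one_ne_bot (hnonab : ¬ ∀ x y : L, ⁅x, y⁆ = 0) :
    LieAlgebra.derivedSeries F L 1 ≠ ⊥ := fun h =>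
  hnonab fun x y => (LieSubmodule.mem_bot _).1 (h ▸ lie_mem_derivedSeries_one (F := F) x y)

/-- A submodule containing the derived algebra is an ideal. -/
def LieIdeal.ofDerivedLE (N : Submodule F L)
    (hN : ∀ x ∈ LieAlgebra.derivedSeries F L 1, x ∈ N) : LieIdeal F L where
  toSubmodule := N
  lie_mem := fun _ => hN _ (lie_mem_derivedSeries_one _ _)

lemma LieIdeal.mem_ofDerivedLE {N : Submodule F L}
    {hN : ∀ x ∈ LieAlgebra.derivedSeries F L 1, x ∈ N} {x : L} :
    x ∈ LieIdeal.ofDerivedLE N hN ↔ x ∈ N := Iff.rfl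

/-- The adjoint action of a Lie algebra on an ideal, by derivations. -/
def LieIdeal.adDerivation (M : LieIdeal F L) : L →ₗ⁅F⁆ LieDerivation F M M where
  toFun x :=
    { toLinearMap := LieModule.toEnd F L M x
      leibniz' := fun a b => Subtype.ext <| by
        change ⁅x, ⁅(a : L), (b : L)⁆⁆ = ⁅(a : L), ⁅x, (b : L)⁆⁆ - ⁅(b : L), ⁅x, (a : L)⁆⁆
        rw [leibniz_lie, ← lie_skew ⁅x, (a : L)⁆ (b : L), neg_add_eq_sub] }
  map_add' x y := LieDerivation.ext fun a => by
    change LieModule.toEnd F L M (x + y) a =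
      LieModule.toEnd F L M x a + LieModule.toEnd F L M y a
    simp
  map_smul' c x := LieDerivation.ext fun a => by
    change LieModule.toEnd F L M (c • x) a = c • LieModule.toEnd F L M x a
    simp
  map_lie' {x y} := LieDerivation.ext fun a => by
    rw [LieDerivation.commutator_apply]
    change ⁅⁅x, y⁆, a⁆ = ⁅x, ⁅y, a⁆⁆ - ⁅y, ⁅x, a⁆⁆
    simp

lemma LieIdeal.adDerivation_toLinearMap (M : LieIdeal F L) (x : L) :
    (M.adDerivation x).toLinearMap = LieModule.toEnd F L M x := rfl

lemma LieIdeal.adDerivation_coe (M : LieIdeal F L) (x : M) :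
    M.adDerivation (x : L) = LieDerivation.ad F M x :=
  LieDerivation.ext fun a => by
    rw [LieDerivation.ad_apply_apply]
    rfl

lemma LieIdeal.coe_toEnd_pow_apply (M : LieIdeal F L) (x : L) (n : ℕ) (a : M) :
    (((LieModule.toEnd F L M x ^ n) a : M) : L) = (LieAlgebra.ad F L x ^ n) (a : L) := by
  induction n with
  | zero => simp
  | succ k ih => rw [pow_succ', pow_succ', Module.End.mul_apply, Module.End.mul_apply, ← ih]; rfl

variable {p : ℕ} {pm : L → L}

lemma LieIdeal.adDerivation_toLinearMap_pow (M : LieIdeal F L)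
    (had : ∀ x, LieAlgebra.ad F L (pm x) = LieAlgebra.ad F L x ^ p) (x : L) :
    (M.adDerivation (pm x)).toLinearMap = (M.adDerivation x).toLinearMap ^ p := by
  refine LinearMap.ext fun a => Subtype.ext ?_
  rw [M.adDerivation_toLinearMap x, M.coe_toEnd_pow_apply, ← had]
  rfl

/-- In a simple restricted Lie algebra every nonzero ideal contains the derived algebra. -/
lemma derivedSeries_one_le_of_ne_bot (hp : p ≠ 0)
    (had : ∀ x, LieAlgebra.ad F L (pm x) = LieAlgebra.ad F L x ^ p)
    (hsimple : ∀ I : LieIdeal F L, (∀ x ∈ I, pm x ∈ I) → I = ⊥ ∨ I = ⊤)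
    {I : LieIdeal F L} (hI : I ≠ ⊥) : LieAlgebra.derivedSeries F L 1 ≤ I := by
  have hmem : ∀ {x : L}, x ∈ I.normalizer ↔ ∀ y : L, ⁅x, y⁆ ∈ I := fun {x} => by
    rw [LieSubmodule.mem_normalizer]
    exact forall_congr' fun y => by rw [← lie_skew, neg_mem_iff]
  have hclosed : ∀ x ∈ I.normalizer, pm x ∈ I.normalizer := fun x hx =>
    hmem.2 fun y => by
      rw [← LieAlgebra.ad_apply F, had]
      exact I.ad_pow_mem (hmem.1 hx) hp y
  rcases hsimple _ hclosed with h | h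
  · exact absurd (le_bot_iff.1 (h ▸ I.le_normalizer)) hI
  · exact derivedSeries_one_le fun x => hmem.1 (h ▸ LieSubmodule.mem_top x)

/-- A `p`-closed submodule containing the derived algebra of a simple restricted Lie algebra is
everything. -/
lemma eq_top_of_derivedSeries_one_le (hnonab : ¬ ∀ x y : L, ⁅x, y⁆ = 0)
    (hsimple : ∀ I : LieIdeal F L, (∀ x ∈ I, pm x ∈ I) → I = ⊥ ∨ I = ⊤)
    {N : Submodule F L} (hN : ∀ x ∈ LieAlgebra.derivedSeries F L 1, x ∈ N)
    (hpm : ∀ x ∈ N, pm x ∈ N) (x : L) : x ∈ N := by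
  rcases hsimple (LieIdeal.ofDerivedLE N hN) hpm with h | h
  · have hle : LieAlgebra.derivedSeries F L 1 ≤ LieIdeal.ofDerivedLE N hN := hN
    exact absurd (le_bot_iff.1 (h ▸ hle)) (derivedSeries_one_ne_bot hnonab)
  · exact LieIdeal.mem_ofDerivedLE.1 (h ▸ LieSubmodule.mem_top x)

/-- The center of a simple restricted Lie algebra is trivial. -/
lemma eq_zero_of_forall_lie_eq_zero (hp : p ≠ 0)
    (had : ∀ x, LieAlgebra.ad F L (pm x) = LieAlgebra.ad F L x ^ p)
    (hnonab : ¬ ∀ x y : L, ⁅x, y⁆ = 0)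
    (hsimple : ∀ I : LieIdeal F L, (∀ x ∈ I, pm x ∈ I) → I = ⊥ ∨ I = ⊤)
    {z : L} (hz : ∀ y : L, ⁅y, z⁆ = 0) : z = 0 := by
  have hclosed : ∀ x ∈ LieAlgebra.center F L, pm x ∈ LieAlgebra.center F L := fun x hx => by
    rw [LieModule.mem_maxTrivSubmodule] at hx ⊢
    have h0 : LieAlgebra.ad F L x = 0 := LinearMap.ext fun y => by
      rw [LieAlgebra.ad_apply, ← lie_skew, hx, neg_zero, LinearMap.zero_apply]
    intro y
    rw [← lie_skew, ← LieAlgebra.ad_apply F, had, h0, zero_pow hp, LinearMap.zero_apply, neg_zero]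
  rcases hsimple _ hclosed with h | h
  · have hz' : z ∈ LieAlgebra.center F L := (LieModule.mem_maxTrivSubmodule F L L z).2 hz
    rwa [h, LieSubmodule.mem_bot] at hz'
  · refine absurd (fun x y => ?_) hnonab
    exact (LieModule.mem_maxTrivSubmodule F L L y).1
      (show y ∈ LieAlgebra.center F L from h ▸ LieSubmodule.mem_top y) x

lemma derivedSeries_one_not_abelian (hp : 2 ≤ p)
    (had : ∀ x, LieAlgebra.ad F L (pm x) = LieAlgebra.ad F L x ^ p)
    (hnonab : ¬ ∀ x y : L, ⁅x, y⁆ = 0)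
    (hsimple : ∀ I : LieIdeal F L, (∀ x ∈ I, pm x ∈ I) → I = ⊥ ∨ I = ⊤) :
    ¬ ∀ x ∈ LieAlgebra.derivedSeries F L 1, ∀ y ∈ LieAlgebra.derivedSeries F L 1,
      ⁅x, y⁆ = 0 := by
  intro hab
  have hpm : ∀ x ∈ LieAlgebra.derivedSeries F L 1, pm x = 0 := fun x hx => by
    refine eq_zero_of_forall_lie_eq_zero (by omega) had hnonab hsimple fun y => ?_
    have hsq : LieAlgebra.ad F L x ^ 2 = 0 := LinearMap.ext fun y => by
      rw [pow_two, Module.End.mul_apply]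
      exact hab x hx _ (lie_mem_derivedSeries_one _ _)
    rw [← lie_skew, ← LieAlgebra.ad_apply F, had, pow_eq_zero_of_le hp hsq,
      LinearMap.zero_apply, neg_zero]
  have htop : ∀ x : L, x ∈ LieAlgebra.derivedSeries F L 1 :=
    eq_top_of_derivedSeries_one_le (N := (LieAlgebra.derivedSeries F L 1).toSubmodule)
      hnonab hsimple (fun _ hx => hx)
      fun x hx => by rw [hpm x hx]; exact zero_mem _
  exact hnonab fun x y => hab x (htop x) y (htop y)

/-- The elements of `L` stabilizing a subspace `N`. -/
def Submodule.lieStabilizer (N : Submodule F L) : Submodule F L where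
  carrier := {x | ∀ y ∈ N, ⁅x, y⁆ ∈ N}
  add_mem' hx hx' y hy := by rw [add_lie]; exact N.add_mem (hx y hy) (hx' y hy)
  zero_mem' y _ := by rw [zero_lie]; exact N.zero_mem
  smul_mem' c x hx y hy := by rw [smul_lie]; exact N.smul_mem c (hx y hy)

/-- The derived algebra of a simple restricted Lie algebra is simple. -/
lemma derivedSeries_one_isSimple (hp : 2 ≤ p)
    (had : ∀ x, LieAlgebra.ad F L (pm x) = LieAlgebra.ad F L x ^ p)
    (hnonab : ¬ ∀ x y : L, ⁅x, y⁆ = 0)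
    (hsimple : ∀ I : LieIdeal F L, (∀ x ∈ I, pm x ∈ I) → I = ⊥ ∨ I = ⊤) :
    LieAlgebra.IsSimple F (LieAlgebra.derivedSeries F L 1) where
  eq_bot_or_eq_top I := by
    let N : Submodule F L :=
      I.toSubmodule.map (LieAlgebra.derivedSeries F L 1).toSubmodule.subtype
    have hmemN : ∀ y : LieAlgebra.derivedSeries F L 1, y ∈ I → (y : L) ∈ N := fun y hy =>
      ⟨y, hy, rfl⟩
    have hstab : ∀ x : L, x ∈ N.lieStabilizer := by
      refine eq_top_of_derivedSeries_one_le hnonab hsimple ?_ ?_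
      · rintro x hx _ ⟨y, hy, rfl⟩
        exact hmemN ⁅⟨x, hx⟩, y⁆ (lie_mem_right F _ I _ _ hy)
      · intro x hx y hy
        rw [← LieAlgebra.ad_apply F, had]
        exact N.ad_pow_mem hx p y hy
    let J : LieIdeal F L := { N with lie_mem := fun {x} y hy => hstab x y hy }
    by_cases hJ : J = ⊥
    · left
      rw [eq_bot_iff]
      intro y hy
      have h0 : (y : L) ∈ J := hmemN y hy
      rw [hJ, LieSubmodule.mem_bot] at h0
      exact (LieSubmodule.mem_bot _).2 (Subtype.ext h0)
    · right
      rw [eq_top_iff]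
      intro y _
      obtain ⟨z, hz, hzy⟩ : (y : L) ∈ N :=
        derivedSeries_one_le_of_ne_bot (by omega) had hsimple hJ y.2
      rwa [← Subtype.ext hzy]
  non_abelian hab := derivedSeries_one_not_abelian hp had hnonab hsimple fun x hx y hy =>
    congrArg Subtype.val (hab.trivial ⟨x, hx⟩ ⟨y, hy⟩)

lemma adDerivation_derivedSeries_one_injective (hp : 2 ≤ p)
    (had : ∀ x, LieAlgebra.ad F L (pm x) = LieAlgebra.ad F L x ^ p)
    (hnonab : ¬ ∀ x y : L, ⁅x, y⁆ = 0)
    (hsimple : ∀ I : LieIdeal F L, (∀ x ∈ I, pm x ∈ I) → I = ⊥ ∨ I = ⊤) :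
    Function.Injective (LieAlgebra.derivedSeries F L 1).adDerivation := by
  have hzero : ∀ x ∈ (LieAlgebra.derivedSeries F L 1).adDerivation.ker,
      ∀ y ∈ LieAlgebra.derivedSeries F L 1, ⁅x, y⁆ = 0 := fun x hx y hy =>
    congrArg Subtype.val (LieDerivation.congr_fun (LieHom.mem_ker.1 hx) ⟨y, hy⟩)
  rw [← LieHom.ker_eq_bot]
  by_contra hker
  exact derivedSeries_one_not_abelian hp had hnonab hsimple fun x hx =>
    hzero x (derivedSeries_one_le_of_ne_bot (by omega) had hsimple hker hx)

/-- The image of a simple restricted Lie algebra in the derivations of its derived algebra is the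
restricted subalgebra generated by the inner derivations. -/
lemma adDerivation_derivedSeries_one_range
    (had : ∀ x, LieAlgebra.ad F L (pm x) = LieAlgebra.ad F L x ^ p)
    (hnonab : ¬ ∀ x y : L, ⁅x, y⁆ = 0)
    (hsimple : ∀ I : LieIdeal F L, (∀ x ∈ I, pm x ∈ I) → I = ⊥ ∨ I = ⊤) :
    (LieAlgebra.derivedSeries F L 1).adDerivation.range =
      sInf {T : LieSubalgebra F
            (LieDerivation F ↥(LieAlgebra.derivedSeries F L 1)
              ↥(LieAlgebra.derivedSeries F L 1)) |
          (∀ x : ↥(LieAlgebra.derivedSeries F L 1),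
            LieDerivation.ad F ↥(LieAlgebra.derivedSeries F L 1) x ∈ T) ∧
          (∀ d, d ∈ T → ∀ d', d'.toLinearMap = d.toLinearMap ^ p → d' ∈ T)} := by
  have hinj : ∀ d d' : LieDerivation F ↥(LieAlgebra.derivedSeries F L 1)
      ↥(LieAlgebra.derivedSeries F L 1), d.toLinearMap = d'.toLinearMap → d = d' :=
    fun d d' h => LieDerivation.ext fun a => LinearMap.congr_fun h a
  apply le_antisymm
  · refine le_sInf ?_
    rintro T ⟨hT, hTp⟩ _ ⟨x, rfl⟩
    refine eq_top_of_derivedSeries_one_le (pm := pm)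
      (N := (T.comap (LieAlgebra.derivedSeries F L 1).adDerivation).toSubmodule)
      hnonab hsimple ?_ ?_ x
    · intro m hm
      have := hT ⟨m, hm⟩
      rwa [← LieIdeal.adDerivation_coe] at this
    · intro y hy
      exact hTp _ hy _ (LieIdeal.adDerivation_toLinearMap_pow _ had y)
  · refine sInf_le ⟨fun x => ?_, ?_⟩
    · rw [← LieIdeal.adDerivation_coe]
      exact LieHom.mem_range_self _ _
    · rintro _ ⟨x, rfl⟩ d' hd'
      refine ⟨pm x, hinj _ _ ?_⟩
      exact (LieIdeal.adDerivation_toLinearMap_pow _ had x).trans hd'.symm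

end RestrictedSimple

theorem simple_restricted_to_simple
    (F L : Type*) [Field F] [LieRing L] [LieAlgebra F L] [Module.Finite F L]
    (p : ℕ) (hp : 0 < p) [CharP F p]
    (pm : L → L) (hpm : IsPMap F p pm)
    -- `(L, [p])` is simple restricted: non-abelian with no proper nonzero `p`-ideal
    (hnonab : ¬ ∀ x y : L, ⁅x, y⁆ = 0)
    (hsimple : ∀ I : LieIdeal F L, (∀ x ∈ I, pm x ∈ I) → I = ⊥ ∨ I = ⊤) :
    -- the derived subalgebra `[L, L]` is a simple Lie algebra
    LieAlgebra.IsSimple F ↥(LieAlgebra.derivedSeries F L 1) ∧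
    -- the `p`-closure of `[L, L]` inside `L` equals `L`
    (∀ S : LieSubalgebra F L,
      (∀ x, x ∈ LieAlgebra.derivedSeries F L 1 → x ∈ S) → (∀ x ∈ S, pm x ∈ S) →
      S = ⊤) ∧
    -- `L` is isomorphic to the restricted subalgebra of `Der_F([L,L])` generated by
    -- `ad([L,L])`
    (∃ e : L ≃ₗ⁅F⁆
        ↥(sInf {T : LieSubalgebra F
            (LieDerivation F ↥(LieAlgebra.derivedSeries F L 1)
              ↥(LieAlgebra.derivedSeries F L 1)) |
          (∀ x : ↥(LieAlgebra.derivedSeries F L 1),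
            LieDerivation.ad F ↥(LieAlgebra.derivedSeries F L 1) x ∈ T) ∧
          (∀ d, d ∈ T → ∀ d', d'.toLinearMap = d.toLinearMap ^ p → d' ∈ T)}),
      ∀ x : L,
        ((e (pm x) : LieDerivation F ↥(LieAlgebra.derivedSeries F L 1)
            ↥(LieAlgebra.derivedSeries F L 1))).toLinearMap =
          ((e x : LieDerivation F ↥(LieAlgebra.derivedSeries F L 1)
            ↥(LieAlgebra.derivedSeries F L 1))).toLinearMap ^ p) := by
  obtain ⟨had, -, -⟩ := hpm
  have hp2 : 2 ≤ p := by
    rcases CharP.char_is_prime_or_zero F p with h | h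
    · exact h.two_le
    · omega
  refine ⟨derivedSeries_one_isSimple hp2 had hnonab hsimple, fun S hS hSp => ?_, ?_⟩
  · exact eq_top_iff.2 fun x _ =>
      eq_top_of_derivedSeries_one_le (N := S.toSubmodule) hnonab hsimple hS hSp x
  · rw [← adDerivation_derivedSeries_one_range had hnonab hsimple]
    refine ⟨LieEquiv.ofInjective _
      (adDerivation_derivedSeries_one_injective hp2 had hnonab hsimple), fun x => ?_⟩
    rw [LieEquiv.ofInjective_apply, LieEquiv.ofInjective_apply]
    exact LieIdeal.adDerivation_toLinearMap_pow _ had x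
end

section
/- Let F be a field of characteristic p > 0 and let M be a finite-dimensional simple Lie algebra over F. Let M^{[p]} ⊆ Der_F(M) be the restricted subalgebra of Der_F(M) generated by the image of the adjoint representation ad(M) (the universal p-envelope of M). Then M^{[p]} is a simple restricted Lie algebra (it has no nonzero proper restricted ideal), and its derived subalgebra satisfies [M^{[p]}, M^{[p]}] = ad(M) ≅ M. -/
/-!
STATEMENT 19: let `M` be a finite-dimensional simple Lie algebra over a field `F` of
characteristic `p > 0`, and let `M^{[p]} ⊆ Der_F(M)` be the universal `p`-envelope of
`M`: the smallest Lie subalgebra of `Der_F(M)` containing `ad(M)` and closed under the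
`p`-map `D ↦ D^p`.  Then `M^{[p]}` is a simple restricted Lie algebra (non-abelian with
no nonzero proper restricted ideal), and `[M^{[p]}, M^{[p]}] = ad(M) ≅ M` (`ad` being
injective since `M` is simple).
-/

set_option maxHeartbeats 1000000

/-- The universal `p`-envelope of `M` inside `Der_F(M) = LieDerivation F M M`: the
smallest Lie subalgebra containing `ad(M)` and closed under `D ↦ D^p`. -/
noncomputable def universalPEnvelope (F M : Type*) [Field F] [LieRing M]
    [LieAlgebra F M] (p : ℕ) : LieSubalgebra F (LieDerivation F M M) :=
  sInf {T : LieSubalgebra F (LieDerivation F M M) |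
    (∀ x : M, LieDerivation.ad F M x ∈ T) ∧
    (∀ d, d ∈ T → ∀ d' : LieDerivation F M M,
      d'.toLinearMap = d.toLinearMap ^ p → d' ∈ T)}

namespace LieDerivation

variable {F M : Type*} [Field F] [LieRing M] [LieAlgebra F M]

/-- In characteristic `p`, the commutator with `D ^ p` is the `p`-th iterate of the commutator
with `D`. -/
lemma lie_eq_iterate_of_toLinearMap_eq_pow {p : ℕ} [Fact p.Prime] [CharP F p] [Nontrivial M]
    {D D' : LieDerivation F M M} (h : D'.toLinearMap = D.toLinearMap ^ p)
    (E : LieDerivation F M M) : ⁅D', E⁆ = (fun X => ⁅D, X⁆)^[p] E := by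
  have : CharP (Module.End F (Module.End F M)) p :=
    charP_of_injective_algebraMap (FaithfulSMul.algebraMap_injective F _) p
  have key (n : ℕ) : ((fun X => ⁅D, X⁆)^[n] E).toLinearMap =
      ((LinearMap.mulLeft F D.toLinearMap - LinearMap.mulRight F D.toLinearMap) ^ n :
        Module.End F (Module.End F M)) E.toLinearMap := by
    induction n with
    | zero => simp
    | succ n ih =>
      rw [Function.iterate_succ_apply', pow_succ', Module.End.mul_apply, ← ih]
      rfl
  apply toLinearMapLieHom_injective F M
  change ⁅D', E⁆.toLinearMap = ((fun X => ⁅D, X⁆)^[p] E).toLinearMap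
  rw [key p, sub_pow_char_of_commute p (LinearMap.commute_mulLeft_right _ _),
    LinearMap.pow_mulLeft, LinearMap.pow_mulRight, ← h]
  rfl

variable [LieAlgebra.IsSimple F M]

/-- A nonzero ideal of an algebra of derivations containing all inner derivations of a simple
Lie algebra contains all inner derivations. -/
lemma ad_mem_of_ne_bot (L : LieSubalgebra F (LieDerivation F M M)) (hL : ∀ x, ad F M x ∈ L)
    {I : LieIdeal F L} (hI : I ≠ ⊥) (x : M) : (⟨ad F M x, hL x⟩ : L) ∈ I := by
  let f : M →ₗ⁅F⁆ L :=
    { toFun := fun y => ⟨ad F M y, hL y⟩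
      map_add' := fun y z => Subtype.ext (map_add _ y z)
      map_smul' := fun c y => Subtype.ext (map_smul _ c y)
      map_lie' := fun {y z} => Subtype.ext (LieHom.map_lie _ y z) }
  suffices h : I.comap f = ⊤ from LieIdeal.mem_comap.mp (h ▸ LieSubmodule.mem_top x)
  refine (LieAlgebra.IsSimple.eq_bot_or_eq_top _).resolve_left fun h => hI ?_
  refine (LieSubmodule.eq_bot_iff _).mpr fun D hD => Subtype.ext (LieDerivation.ext fun y => ?_)
  have hmem : D.1 y ∈ I.comap f := by
    rw [LieIdeal.mem_comap]
    have : f (D.1 y) = ⁅D, f y⁆ := Subtype.ext (lie_der_ad_eq_ad_der D.1 y).symm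
    rw [this]
    exact lie_mem_left F L I D (f y) hD
  rw [h] at hmem
  exact (LieSubmodule.mem_bot _).mp hmem

end LieDerivation

namespace universalPEnvelope

open LieDerivation

variable {F M : Type*} [Field F] [LieRing M] [LieAlgebra F M] {p : ℕ}

lemma mem_iff {D : LieDerivation F M M} :
    D ∈ universalPEnvelope F M p ↔ ∀ T : LieSubalgebra F (LieDerivation F M M),
      (∀ x, ad F M x ∈ T) ∧
        (∀ d, d ∈ T → ∀ d' : LieDerivation F M M,
          d'.toLinearMap = d.toLinearMap ^ p → d' ∈ T) → D ∈ T := by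
  rw [universalPEnvelope, ← SetLike.mem_coe, LieSubalgebra.coe_sInf]
  exact Set.mem_iInter₂

lemma ad_mem (x : M) : ad F M x ∈ universalPEnvelope F M p :=
  mem_iff.mpr fun _ hT => hT.1 x

lemma mem_of_toLinearMap_eq_pow {D D' : LieDerivation F M M}
    (hD : D ∈ universalPEnvelope F M p) (h : D'.toLinearMap = D.toLinearMap ^ p) :
    D' ∈ universalPEnvelope F M p :=
  mem_iff.mpr fun T hT => hT.2 D (mem_iff.mp hD T hT) D' h

lemma le_of_closed {T : LieSubalgebra F (LieDerivation F M M)} (had : ∀ x, ad F M x ∈ T)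
    (hp : ∀ D ∈ T, ∀ D' : LieDerivation F M M, D'.toLinearMap = D.toLinearMap ^ p → D' ∈ T) :
    universalPEnvelope F M p ≤ T :=
  sInf_le ⟨had, hp⟩

/-- Bracketing with an element of the `p`-envelope maps every derivation to an inner one. -/
lemma lie_mem_range_ad [Fact p.Prime] [CharP F p] [Nontrivial M] {D : LieDerivation F M M}
    (hD : D ∈ universalPEnvelope F M p) (E : LieDerivation F M M) :
    ⁅D, E⁆ ∈ (ad F M).idealRange := by
  let T : LieSubalgebra F (LieDerivation F M M) :=
    { carrier := {D | ∀ E, ⁅D, E⁆ ∈ (ad F M).idealRange}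
      add_mem' := fun {a b} ha hb E => by rw [add_lie]; exact add_mem (ha E) (hb E)
      zero_mem' := fun E => by rw [zero_lie]; exact zero_mem _
      smul_mem' := fun c a ha E => by
        rw [smul_lie]; exact Submodule.smul_mem (ad F M).idealRange.toSubmodule c (ha E)
      lie_mem' := fun {a b} ha _ E => lie_mem_left F _ _ _ E (ha b) }
  refine le_of_closed (T := T) (fun x E => ?_) (fun D hD D' h E => ?_) hD E
  · exact lie_mem_left F _ _ _ E (mem_ad_idealRange_iff.mpr ⟨x, rfl⟩)
  · obtain ⟨n, hn⟩ := Nat.exists_eq_succ_of_ne_zero (Fact.out : p.Prime).ne_zero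
    rw [lie_eq_iterate_of_toLinearMap_eq_pow h, hn, Function.iterate_succ_apply']
    exact hD _

end universalPEnvelope

theorem simple_to_simple_restricted
    (F M : Type*) [Field F] [LieRing M] [LieAlgebra F M] [Module.Finite F M]
    (p : ℕ) (hp : 0 < p) [CharP F p] [LieAlgebra.IsSimple F M] :
    -- `M^{[p]}` is non-abelian …
    (¬ ∀ z z' : ↥(universalPEnvelope F M p), ⁅z, z'⁆ = 0) ∧
    -- … and has no nonzero proper restricted ideal
    (∀ I : LieIdeal F ↥(universalPEnvelope F M p),
      (∀ z ∈ I, ∀ z' : ↥(universalPEnvelope F M p),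
        (z' : LieDerivation F M M).toLinearMap =
          (z : LieDerivation F M M).toLinearMap ^ p → z' ∈ I) →
      I = ⊥ ∨ I = ⊤) ∧
    -- the derived subalgebra of `M^{[p]}` is exactly `ad(M)` …
    ({z : LieDerivation F M M |
        ∃ h : z ∈ universalPEnvelope F M p,
          (⟨z, h⟩ : ↥(universalPEnvelope F M p)) ∈
            LieAlgebra.derivedSeries F ↥(universalPEnvelope F M p) 1} =
      Set.range (LieDerivation.ad F M)) ∧
    -- … which is isomorphic to `M` (`ad` is injective)
    Function.Injective (LieDerivation.ad F M) := by
  have := LieAlgebra.IsSimple.non_abelian F (L := M)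
  have : Nontrivial M := by
    by_contra h
    rw [not_nontrivial_iff_subsingleton] at h
    exact this ⟨fun x y => Subsingleton.elim _ _⟩
  have : Fact p.Prime := ⟨(CharP.char_is_prime_or_zero F p).resolve_right hp.ne'⟩
  have hinj : Function.Injective (LieDerivation.ad F M) :=
    LieDerivation.injective_ad_of_center_eq_bot (LieAlgebra.center_eq_bot F M)
  have hna : ¬ ∀ z z' : ↥(universalPEnvelope F M p), ⁅z, z'⁆ = 0 := fun h =>
    LieAlgebra.IsSimple.non_abelian F (L := M) ⟨fun x y => hinj <| by
      rw [LieHom.map_lie, map_zero]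
      exact congrArg Subtype.val
        (h ⟨_, universalPEnvelope.ad_mem x⟩ ⟨_, universalPEnvelope.ad_mem y⟩)⟩
  refine ⟨hna, fun I hI => ?_, ?_, hinj⟩
  · refine or_iff_not_imp_left.mpr fun hbot => eq_top_iff.mpr fun z _ => ?_
    have hle : universalPEnvelope F M p ≤
        (LieIdeal.toLieSubalgebra F _ I).map (universalPEnvelope F M p).incl := by
      refine universalPEnvelope.le_of_closed
        (fun x => ⟨_, LieDerivation.ad_mem_of_ne_bot _ universalPEnvelope.ad_mem hbot x, rfl⟩) ?_
      rintro _ ⟨w, hw, rfl⟩ D' h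
      exact ⟨⟨D', universalPEnvelope.mem_of_toLinearMap_eq_pow w.2 h⟩, hI w hw _ h, rfl⟩
    obtain ⟨w, hw, hwz⟩ := hle z.2
    exact (Subtype.ext hwz : w = z) ▸ hw
  · have hder : LieAlgebra.derivedSeries F ↥(universalPEnvelope F M p) 1 ≠ ⊥ := fun h =>
      hna fun z z' => (LieSubmodule.mem_bot _).mp <| h.le <|
        LieSubmodule.lie_mem_lie (LieSubmodule.mem_top z) (LieSubmodule.mem_top z')
    ext D
    constructor
    · rintro ⟨hD, hmem⟩
      have hle : LieAlgebra.derivedSeries F ↥(universalPEnvelope F M p) 1 ≤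
          (LieDerivation.ad F M).idealRange.comap (universalPEnvelope F M p).incl :=
        (LieSubmodule.lie_le_iff _ _ _).mpr fun z _ z' _ => LieIdeal.mem_comap.mpr
          (universalPEnvelope.lie_mem_range_ad z.2 z'.1)
      exact LieDerivation.mem_ad_idealRange_iff.mp (LieIdeal.mem_comap.mp (hle hmem))
    · rintro ⟨x, rfl⟩
      exact ⟨universalPEnvelope.ad_mem x,
        LieDerivation.ad_mem_of_ne_bot _ universalPEnvelope.ad_mem hder x⟩
end
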